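/- arXiv:2602.10293 — 11 statements merged into one kernel-verified Lean document; each statement's English description precedes it below -/
import Mathlib

section
/- For every integer m ≥ 1, the number of partial rankings of m objects — that is, the number of ordered lists without repetition of elements from an m-element set, including the empty list, which equals Σ_{k=0}^{m} m!/(m−k)! — is exactly ⌊e·m!⌋, where e is Euler's number. -/
open Finset Nat in
/-- A list without repetition is an injection from some `Fin k`. -/
theorem ncard_nodup_list_fin (m : ℕ) :
    {l : List (Fin m) | l.Nodup}.ncard = ∑ k ∈ range (m + 1), m.descFactorial k := by
  let f : (Σ k : Fin (m + 1), (Fin k ↪ Fin m)) → {l : List (Fin m) | l.Nodup} :=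
    fun x => ⟨List.ofFn x.2, List.nodup_ofFn.2 x.2.injective⟩
  have hf : f.Bijective := by
    constructor
    · rintro ⟨⟨j, hj⟩, g⟩ ⟨⟨k, hk⟩, h⟩ hgh
      have hlist : List.ofFn g = List.ofFn h := congrArg Subtype.val hgh
      obtain rfl : j = k := by simpa using congrArg List.length hlist
      obtain rfl : g = h := DFunLike.coe_injective (List.ofFn_injective hlist)
      rfl
    · rintro ⟨l, hl⟩
      have hlen : l.length < m + 1 := by
        simpa [Nat.lt_succ_iff] using List.Nodup.length_le_card hl
      exact ⟨⟨⟨l.length, hlen⟩, ⟨l.get, List.nodup_iff_injective_get.1 hl⟩⟩,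
        Subtype.ext (List.ofFn_get l)⟩
  rw [← Nat.card_coe_set_eq, ← Nat.card_congr (Equiv.ofBijective f hf), Nat.card_eq_fintype_card,
    Fintype.card_sigma, ← Fin.sum_univ_eq_sum_range]
  simp [Fintype.card_embedding_eq]

open Finset Nat in
theorem cast_sum_descFactorial_eq_sum_mul_factorial (m : ℕ) :
    ((∑ k ∈ range (m + 1), m.descFactorial k : ℕ) : ℝ) =
      (∑ k ∈ range (m + 1), (1 : ℝ) ^ k / k !) * m ! := by
  rw [← sum_range_reflect, Nat.cast_sum, sum_mul]
  refine sum_congr rfl fun k hk => ?_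
  have hkm : k ≤ m := Nat.lt_succ_iff.1 (mem_range.1 hk)
  have h := Nat.factorial_mul_descFactorial (Nat.sub_le m k)
  rw [Nat.sub_sub_self hkm] at h
  rw [Nat.add_sub_cancel, ← h, Nat.cast_mul, one_pow]
  field_simp

open Finset Nat in
theorem sum_descFactorial_eq_floor (m : ℕ) (hm : 1 ≤ m) :
    ∑ k ∈ range (m + 1), m.descFactorial k = ⌊Real.exp 1 * (m ! : ℝ)⌋₊ := by
  symm
  rw [Nat.floor_eq_iff (by positivity), cast_sum_descFactorial_eq_sum_mul_factorial]
  have hfac : (0 : ℝ) < m ! := by positivity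
  constructor
  · gcongr
    exact Real.sum_le_exp_of_nonneg zero_le_one (m + 1)
  · have hbound := (abs_le.1 (Real.exp_bound (x := 1) (by simp) (Nat.succ_pos m))).2
    have htail : ((m + 1).succ / ((m + 1)! * (m + 1 : ℕ)) : ℝ) * m ! < 1 := by
      have hm' : (1 : ℝ) ≤ m := by exact_mod_cast hm
      rw [Nat.factorial_succ]
      push_cast
      rw [div_mul_eq_mul_div, div_lt_one (by positivity)]
      nlinarith [mul_pos hfac (by nlinarith : (0 : ℝ) < (m + 1) * (m + 1) - (m + 1 + 1))]
    rw [abs_one, one_pow, one_mul] at hbound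
    have := mul_le_mul_of_nonneg_right hbound hfac.le
    rw [sub_mul] at this
    linarith

/-- For every `m ≥ 1`, the number of partial rankings of `m` objects
(ordered lists without repetition from an `m`-element set, including the empty list),
which equals `∑_{k=0}^{m} m!/(m-k)!`, is exactly `⌊e · m!⌋`. -/
theorem count_partial_rankings_eq_floor_e_mul_factorial (m : ℕ) (hm : 1 ≤ m) :
    {l : List (Fin m) | l.Nodup}.ncard = ⌊Real.exp 1 * (Nat.factorial m : ℝ)⌋₊ ∧
    (∑ k ∈ Finset.range (m + 1), Nat.factorial m / Nat.factorial (m - k)) =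
      ⌊Real.exp 1 * (Nat.factorial m : ℝ)⌋₊ := by
  refine ⟨(ncard_nodup_list_fin m).trans (sum_descFactorial_eq_floor m hm), ?_⟩
  rw [← sum_descFactorial_eq_floor m hm]
  refine Finset.sum_congr rfl fun k hk => ?_
  exact (Nat.descFactorial_eq_div (Nat.lt_succ_iff.1 (Finset.mem_range.1 hk))).symm
end

section
/- For every integer m ≥ 2, the ballot graph 𝒢_m with the empty ballot included as a vertex is m-regular: every vertex has exactly m neighbors. -/
/-- `σ` is the rank function of a (possibly partial) ballot on `m` candidates, under the
pessimistic convention: the `k` listed candidates get their positions `1,…,k` and all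
unlisted candidates get rank `m`.  (A ballot listing `m-1` candidates has the same rank
function as its unique completion, realizing the identification of such ballots.) -/
def IsBallot (m : ℕ) (σ : Fin m → ℕ) : Prop :=
  (∀ i, 1 ≤ σ i ∧ σ i ≤ m) ∧
  (∀ i i', σ i < m → σ i = σ i' → i = i') ∧
  (∀ i j, 1 ≤ j → j ≤ σ i → σ i < m → ∃ i', σ i' = j)

/-- A partial ballot on `m` candidates, encoded by its rank function. -/
def Ballot (m : ℕ) : Type := {σ : Fin m → ℕ // IsBallot m σ}

/-- The Borda embedding: candidate `i` receives `m - σ i` Borda points. -/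
noncomputable def bordaEmb (m : ℕ) (σ : Fin m → ℕ) (i : Fin m) : ℝ :=
  (m : ℝ) - (σ i : ℝ)

/-- The Borda distance: half the `L¹` distance between Borda embeddings. -/
noncomputable def dB (m : ℕ) (σ τ : Fin m → ℕ) : ℝ :=
  (1 / 2) * ∑ i, |bordaEmb m σ i - bordaEmb m τ i|

/-- The head-to-head coordinate of the pair `(i,j)`: `+1` if `σ i > σ j`, `0` on a tie,
`-1` if `σ i < σ j`. -/
noncomputable def hcoord {m : ℕ} (σ : Fin m → ℕ) (i j : Fin m) : ℝ :=
  if σ j < σ i then 1 else if σ i = σ j then 0 else -1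

/-- The head-to-head distance: half the `L¹` distance between head-to-head embeddings,
summing over pairs `i < j`. -/
noncomputable def dH {m : ℕ} (σ τ : Fin m → ℕ) : ℝ :=
  (1 / 2) * ∑ p ∈ Finset.univ.filter (fun p : Fin m × Fin m => p.1 < p.2),
    |hcoord σ p.1 p.2 - hcoord τ p.1 p.2|

/-- The number of strong disagreements: pairs strictly ranked in opposite orders. -/
def strDis {m : ℕ} (σ τ : Fin m → ℕ) : ℕ :=
  (Finset.univ.filter (fun p : Fin m × Fin m => p.1 < p.2 ∧
    ((σ p.1 < σ p.2 ∧ τ p.2 < τ p.1) ∨ (σ p.2 < σ p.1 ∧ τ p.1 < τ p.2)))).card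

/-- The number of weak disagreements: pairs tied by exactly one of the two ballots. -/
def wkDis {m : ℕ} (σ τ : Fin m → ℕ) : ℕ :=
  (Finset.univ.filter (fun p : Fin m × Fin m => p.1 < p.2 ∧
    ((σ p.1 = σ p.2 ∧ τ p.1 ≠ τ p.2) ∨ (σ p.1 ≠ σ p.2 ∧ τ p.1 = τ p.2)))).card

/-- Two ballots differ by a neighbor swap: two listed candidates in consecutive
positions are exchanged and everything else is unchanged.  (When the lower of the two
positions is `m`, the candidate there must be genuinely listed, i.e. the ballot is
complete, which is expressed by uniqueness of the candidate with rank `m`.) -/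
def SwapAdj (m : ℕ) (σ τ : Ballot m) : Prop :=
  ∃ a b : Fin m, a ≠ b ∧ σ.1 b = σ.1 a + 1 ∧
    (σ.1 b < m ∨ ∀ c, σ.1 c = m → c = b) ∧
    τ.1 a = σ.1 b ∧ τ.1 b = σ.1 a ∧ ∀ c, c ≠ a → c ≠ b → τ.1 c = σ.1 c

/-- `τ` extends `σ` by listing one additional (previously unlisted) candidate at the
next available position. -/
def ExtAdj (m : ℕ) (σ τ : Ballot m) : Prop :=
  ∃ c, σ.1 c = m ∧ τ.1 c < m ∧ ∀ i, i ≠ c → τ.1 i = σ.1 i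

/-- Adjacency in the ballot graph `𝒢_m`: a neighbor swap, or a truncation/extension. -/
def BallotAdj (m : ℕ) (σ τ : Ballot m) : Prop :=
  SwapAdj m σ τ ∨ ExtAdj m σ τ ∨ ExtAdj m τ σ

/-- A rank function `σ` is a ballot listing exactly `k` candidates, where a complete ranking is
regarded as listing `m - 1` of them. -/
structure IsBallotOfLength (m k : ℕ) (σ : Fin m → ℕ) : Prop where
  lt : k < m
  pos : ∀ i, 1 ≤ σ i
  le_or_eq : ∀ i, σ i ≤ k ∨ σ i = m
  inj : ∀ i i', σ i ≤ k → σ i = σ i' → i = i'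
  surj : ∀ j, 1 ≤ j → j ≤ k → ∃ i, σ i = j

theorem IsBallotOfLength.isBallot {m k : ℕ} {σ : Fin m → ℕ} (h : IsBallotOfLength m k σ) :
    IsBallot m σ := by
  obtain ⟨hlt, hpos, hle, hinj, hsurj⟩ := h
  refine ⟨fun i => ⟨hpos i, ?_⟩, fun i i' hi => ?_, fun i j hj hji hi => ?_⟩
  · rcases hle i with h | h <;> omega
  · exact hinj i i' ((hle i).resolve_right hi.ne)
  · exact hsurj j hj (hji.trans ((hle i).resolve_right hi.ne))

theorem IsBallot.exists_isBallotOfLength {m : ℕ} (hm : 0 < m) {σ : Fin m → ℕ}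
    (h : IsBallot m σ) : ∃ k, IsBallotOfLength m k σ := by
  obtain ⟨hr, hinj, hsurj⟩ := h
  let L := Finset.univ.filter fun i => σ i < m
  have hk : L.sup σ < m := (Finset.sup_lt_iff hm).2 fun i hi => (Finset.mem_filter.1 hi).2
  refine ⟨L.sup σ, hk, fun i => (hr i).1, fun i => ?_, fun i i' hi => ?_, fun j hj hjk => ?_⟩
  · by_cases hi : σ i < m
    · exact Or.inl (Finset.le_sup (f := σ) (by simpa [L] using hi))
    · exact Or.inr (by have := (hr i).2; omega)
  · exact hinj i i' (hi.trans_lt hk)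
  · obtain ⟨i, hi, hji⟩ := (Finset.le_sup_iff hj).1 hjk
    exact hsurj i j hj hji (Finset.mem_filter.1 hi).2

namespace IsBallotOfLength

variable {m k : ℕ} {σ : Fin m → ℕ}

theorem card_unlisted (h : IsBallotOfLength m k σ) :
    (Finset.univ.filter fun i => σ i = m).card = m - k := by
  have hlt := h.lt
  have h1 : (Finset.univ.filter fun i => σ i ≤ k).card = k := by
    rw [← Finset.card_image_of_injOn (f := σ)
      (fun i hi i' _ e => h.inj i i' (by simpa using hi) e)]
    trans (Finset.Icc 1 k).card
    · congr 1
      ext j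
      simp only [Finset.mem_image, Finset.mem_filter, Finset.mem_univ, true_and, Finset.mem_Icc]
      constructor
      · rintro ⟨i, hi, rfl⟩
        exact ⟨h.pos i, hi⟩
      · rintro ⟨hj, hjk⟩
        obtain ⟨i, rfl⟩ := h.surj j hj hjk
        exact ⟨i, hjk, rfl⟩
    · simp
  have h2 := Finset.card_filter_add_card_filter_not (s := (Finset.univ : Finset (Fin m)))
    (fun i => σ i ≤ k)
  have h3 : (Finset.univ.filter fun i => ¬ σ i ≤ k) = Finset.univ.filter fun i => σ i = m := by
    ext i
    have := h.le_or_eq i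
    simp only [Finset.mem_filter, Finset.mem_univ, true_and]
    omega
  rw [h1, h3, Finset.card_univ, Fintype.card_fin] at h2
  omega

theorem exists_eq (h : IsBallotOfLength m k σ) : ∃ i, σ i = m := by
  have hlt := h.lt
  have h1 := h.card_unlisted
  obtain ⟨i, hi⟩ := Finset.card_pos.1 (h1 ▸ (by omega : 0 < m - k))
  exact ⟨i, by simpa using hi⟩

theorem unique_of_complete (h : IsBallotOfLength m k σ) (hk : k + 1 = m) {i i' : Fin m}
    (hi : σ i = m) (hi' : σ i' = m) : i = i' :=
  Finset.card_le_one.1 (by rw [h.card_unlisted]; omega) i (by simpa using hi) i' (by simpa using hi')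

theorem exists_ne (h : IsBallotOfLength m k σ) (hk : k + 1 < m) (i : Fin m) :
    ∃ i', σ i' = m ∧ i' ≠ i := by
  obtain ⟨i', hi', hne⟩ := Finset.exists_mem_ne
    (s := Finset.univ.filter fun i => σ i = m) (by rw [h.card_unlisted]; omega) i
  exact ⟨i', by simpa using hi', hne⟩

theorem extend (h : IsBallotOfLength m k σ) (hk : k + 1 < m) {c : Fin m} (hc : σ c = m) :
    IsBallotOfLength m (k + 1) (Function.update σ c (k + 1)) := by
  obtain ⟨hlt, hpos, hle, hinj, hsurj⟩ := h
  refine ⟨hk, fun i => ?_, fun i => ?_, fun i i' => ?_, fun j hj hjk => ?_⟩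
  · grind [Function.update_apply]
  · grind [Function.update_apply]
  · grind [Function.update_apply]
  · by_cases hj' : j = k + 1
    · exact ⟨c, by simp [hj']⟩
    · obtain ⟨i, hi⟩ := hsurj j hj (by omega)
      exact ⟨i, by grind [Function.update_apply]⟩

theorem truncate (h : IsBallotOfLength m k σ) :
    IsBallotOfLength m (k - 1) (fun c => if σ c = k then m else σ c) := by
  obtain ⟨hlt, hpos, hle, hinj, hsurj⟩ := h
  refine ⟨by omega, fun i => ?_, fun i => ?_, fun i i' => ?_, fun j hj hjk => ?_⟩
  · grind
  · grind
  · grind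
  · obtain ⟨i, hi⟩ := hsurj j hj (by omega)
    exact ⟨i, by grind⟩

theorem swap (h : IsBallotOfLength m k σ) {r : ℕ} (hr : 1 ≤ r) (hrk : r < k ∨ r = k ∧ k + 1 = m) :
    IsBallotOfLength m k (fun c => Equiv.swap r (r + 1) (σ c)) := by
  have hu := fun hk i i' => h.unique_of_complete hk (i := i) (i' := i')
  obtain ⟨e, he⟩ := h.exists_eq
  obtain ⟨hlt, hpos, hle, hinj, hsurj⟩ := h
  refine ⟨hlt, fun i => ?_, fun i => ?_, fun i i' hi e => ?_, fun j hj hjk => ?_⟩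
  · grind
  · grind
  · have e' := (Equiv.swap r (r + 1)).injective e
    grind
  · have hs : ∃ i, σ i = Equiv.swap r (r + 1) j := by
      grind
    obtain ⟨i, hi⟩ := hs
    exact ⟨i, by simp [hi]⟩

end IsBallotOfLength

/-- The neighbor, in the ballot graph, of a ballot `σ` listing `k` candidates that is attached to
the candidate `i`: an unlisted `i` is appended, the last listed candidate is removed, and any
other `i` is exchanged with its successor. For complete `σ` the last two candidates are treated
as the exchange of the two and the removal of both. -/
def ballotNeighbor (m k : ℕ) (σ : Fin m → ℕ) (i : Fin m) : Fin m → ℕ :=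
  if σ i = m then
    if k + 1 < m then Function.update σ i (k + 1) else fun c => if σ c = k then m else σ c
  else if σ i = k ∧ k + 1 < m then fun c => if σ c = k then m else σ c
  else fun c => Equiv.swap (σ i) (σ i + 1) (σ c)

namespace IsBallotOfLength

variable {m k : ℕ} {σ : Fin m → ℕ}

theorem isBallot_ballotNeighbor (h : IsBallotOfLength m k σ) (i : Fin m) :
    IsBallot m (ballotNeighbor m k σ i) := by
  have := h.lt
  have := h.pos i
  have := h.le_or_eq i
  unfold ballotNeighbor
  split_ifs with h1 h2 h3
  · exact (h.extend h2 h1).isBallot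
  · exact h.truncate.isBallot
  · exact h.truncate.isBallot
  · exact (h.swap (h.pos i) (by omega)).isBallot

theorem ballotNeighbor_injective (h : IsBallotOfLength m k σ) :
    Function.Injective (ballotNeighbor m k σ) := by
  intro i i' e
  have hu := fun hk => h.unique_of_complete hk (i := i) (i' := i')
  have ei := congrFun e i
  have ei' := congrFun e i'
  obtain ⟨hlt, hpos, hle, hinj, hsurj⟩ := h
  have := hpos i
  have := hpos i'
  have := hle i
  have := hle i'
  have := hinj i i'
  clear e hpos hle hinj hsurj
  unfold ballotNeighbor at ei ei'
  split_ifs at ei ei' <;>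
    simp only [Function.update_apply, Equiv.swap_apply_def] at ei ei' <;> grind

theorem ballotAdj_ballotNeighbor (hm : 2 ≤ m) (h : IsBallotOfLength m k σ) (i : Fin m) :
    BallotAdj m ⟨σ, h.isBallot⟩ ⟨ballotNeighbor m k σ i, h.isBallot_ballotNeighbor i⟩ := by
  have hlt := h.lt
  have hpi := h.pos i
  have hlei := h.le_or_eq i
  have htr : 1 ≤ k → ∃ c, (if σ c = k then m else σ c) = m ∧ σ c < m ∧
      ∀ i, i ≠ c → σ i = if σ i = k then m else σ i := by
    intro hk
    obtain ⟨c, hc⟩ := h.surj k hk le_rfl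
    refine ⟨c, by simp [hc], by omega, fun j hj => ?_⟩
    have := h.inj c j hc.le
    grind
  unfold BallotAdj SwapAdj ExtAdj
  simp only [ballotNeighbor]
  split_ifs with h1 h2 h3
  · exact Or.inr (Or.inl ⟨i, h1, by simpa using h2, fun j hj => by simp [hj]⟩)
  · exact Or.inr (Or.inr (htr (by omega)))
  · exact Or.inr (Or.inr (htr (by omega)))
  · clear htr
    left
    have hb : ∃ b, σ b = σ i + 1 := by
      by_cases hik : σ i < k
      · exact h.surj _ (by omega) (by omega)
      · obtain ⟨e, he⟩ := h.exists_eq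
        exact ⟨e, by omega⟩
    obtain ⟨b, hb⟩ := hb
    refine ⟨i, b, fun hib => ?_, hb, ?_, by simp [hb], by simp [hb], fun c hca hcb => ?_⟩
    · subst hib
      omega
    · by_cases hbm : σ b < m
      · exact Or.inl hbm
      · exact Or.inr fun c hc => h.unique_of_complete (by omega) hc (by omega)
    · have h4 := h.inj i c (by omega)
      have h5 := h.inj b c
      have h6 := fun hk => h.unique_of_complete hk (i := c) (i' := b)
      apply Equiv.swap_apply_of_ne_of_ne <;> grind

theorem exists_ballotNeighbor_eq_of_swap (h : IsBallotOfLength m k σ) {τ : Ballot m}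
    (hτ : SwapAdj m ⟨σ, h.isBallot⟩ τ) : ∃ i, ballotNeighbor m k σ i = τ.1 := by
  obtain ⟨a, b, hab, hb, hlast, ha', hb', hc⟩ := hτ
  simp only at hb hlast ha' hb' hc
  refine ⟨a, funext fun c => ?_⟩
  have hlt := h.lt
  have hlb := h.le_or_eq b
  have hla := h.le_or_eq a
  have hne := fun hk => h.exists_ne hk b
  have h4 := h.inj a c
  have h5 := h.inj b c
  grind [ballotNeighbor]

theorem exists_ballotNeighbor_eq_of_ext (h : IsBallotOfLength m k σ) {τ : Ballot m}
    (hτ : ExtAdj m ⟨σ, h.isBallot⟩ τ) : ∃ i, ballotNeighbor m k σ i = τ.1 := by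
  obtain ⟨c, hcm, hc, hne⟩ := hτ
  simp only at hcm hne
  obtain ⟨hr, hinj, hsurj⟩ := τ.2
  have h1 : k < τ.1 c := by
    by_contra! hle
    obtain ⟨i, hi⟩ := h.surj _ (hr c).1 hle
    have := hinj c i hc
    grind
  have h2 : τ.1 c ≤ k + 1 := by
    by_contra! hgt
    obtain ⟨i, hi⟩ := hsurj c (k + 1) (by omega) (by omega) hc
    have := h.le_or_eq i
    grind
  refine ⟨c, funext fun i => ?_⟩
  rw [ballotNeighbor, if_pos hcm, if_pos (by omega), Function.update_apply]
  grind

theorem exists_ballotNeighbor_eq_of_ext_symm (h : IsBallotOfLength m k σ) {τ : Ballot m}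
    (hτ : ExtAdj m τ ⟨σ, h.isBallot⟩) : ∃ i, ballotNeighbor m k σ i = τ.1 := by
  obtain ⟨c, hcm, hc, hne⟩ := hτ
  simp only at hc hne
  obtain ⟨hr, hinj, hsurj⟩ := τ.2
  have hlt := h.lt
  have hle : σ c ≤ k := (h.le_or_eq c).resolve_right hc.ne
  have hk : σ c = k := by
    by_contra hne'
    have hp := h.pos c
    obtain ⟨i, hi⟩ := h.surj k (by omega) le_rfl
    have hi' : τ.1 i = k := by grind
    obtain ⟨j, hj⟩ := hsurj i (σ c) hp (by omega) (by omega)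
    have := h.inj c j hle
    grind
  have hτ' : τ.1 = fun j => if σ j = k then m else σ j := by
    funext j
    have := h.inj c j hle
    grind
  by_cases hkm : k + 1 < m
  · exact ⟨c, by rw [hτ', ballotNeighbor, if_neg hc.ne, if_pos ⟨hk, hkm⟩]⟩
  · obtain ⟨e, he⟩ := h.exists_eq
    exact ⟨e, by rw [hτ', ballotNeighbor, if_pos he, if_neg hkm]⟩

end IsBallotOfLength

/-- For every `m ≥ 2`, the ballot graph `𝒢_m` (with the empty ballot
included as a vertex) is `m`-regular: every vertex has exactly `m` neighbors. -/
theorem ballotGraph_regular (m : ℕ) (hm : 2 ≤ m) (σ : Ballot m) :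
    {τ : Ballot m | BallotAdj m σ τ}.ncard = m := by
  obtain ⟨σ, hσ⟩ := σ
  obtain ⟨k, h⟩ := hσ.exists_isBallotOfLength (by omega)
  let f : Fin m → Ballot m := fun i => ⟨ballotNeighbor m k σ i, h.isBallot_ballotNeighbor i⟩
  have hf : Function.Injective f := fun i i' e =>
    h.ballotNeighbor_injective (congrArg Subtype.val e)
  have hrange : {τ : Ballot m | BallotAdj m ⟨σ, hσ⟩ τ} = Set.range f := by
    ext τ
    constructor
    · intro hτ
      have : ∃ i, ballotNeighbor m k σ i = τ.1 := by
        rcases hτ with hτ | hτ | hτ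
        · exact h.exists_ballotNeighbor_eq_of_swap hτ
        · exact h.exists_ballotNeighbor_eq_of_ext hτ
        · exact h.exists_ballotNeighbor_eq_of_ext_symm hτ
      obtain ⟨i, hi⟩ := this
      exact ⟨i, Subtype.ext hi⟩
    · rintro ⟨i, rfl⟩
      exact h.ballotAdj_ballotNeighbor hm i
  rw [hrange, ← Set.image_univ, Set.ncard_image_of_injective _ hf, Set.ncard_univ, Nat.card_fin]
end

section
/- For all partial ballots σ, τ on m candidates, the path-metric distance between σ and τ in the ballot graph 𝒢_m equals d_H(σ,τ). -/
/-- Weighted adjacency in the ballot graph `𝒢_m`: neighbor swaps have weight `1`, and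
an extension of a ballot of length `k-1` to one of length `k` (the new candidate being
placed at position `k`) has weight `(m-k)/2`, in either direction. -/
def BallotAdjW (m : ℕ) (σ τ : Ballot m) (w : ℝ) : Prop :=
  (SwapAdj m σ τ ∧ w = 1) ∨
  (∃ c, σ.1 c = m ∧ τ.1 c < m ∧ (∀ i, i ≠ c → τ.1 i = σ.1 i) ∧
    w = ((m : ℝ) - (τ.1 c : ℝ)) / 2) ∨
  (∃ c, τ.1 c = m ∧ σ.1 c < m ∧ (∀ i, i ≠ c → σ.1 i = τ.1 i) ∧
    w = ((m : ℝ) - (σ.1 c : ℝ)) / 2)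

/-- `BallotReach m σ τ c` holds when there is a finite edge-path from `σ` to `τ` in the
ballot graph `𝒢_m` whose edge weights sum to `c`. -/
inductive BallotReach (m : ℕ) : Ballot m → Ballot m → ℝ → Prop
  | refl (σ : Ballot m) : BallotReach m σ σ 0
  | step {σ τ ρ : Ballot m} {w c : ℝ} :
      BallotAdjW m σ τ w → BallotReach m τ ρ c → BallotReach m σ ρ (w + c)

/-- The path metric of the ballot graph `𝒢_m`: the infimum over all finite edge-paths
joining two vertices of the sum of the edge weights. -/
noncomputable def ballotGraphDist (m : ℕ) (σ τ : Ballot m) : ℝ :=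
  sInf {c : ℝ | BallotReach m σ τ c}

theorem hcoord_swap {m : ℕ} (σ : Fin m → ℕ) (i j : Fin m) :
    hcoord σ j i = -hcoord σ i j := by
  unfold hcoord
  split_ifs <;> first | omega | norm_num

theorem dH_nonneg {m : ℕ} (σ τ : Fin m → ℕ) : 0 ≤ dH σ τ := by
  unfold dH
  positivity

theorem dH_self {m : ℕ} (σ : Fin m → ℕ) : dH σ σ = 0 := by
  simp [dH]

theorem dH_comm {m : ℕ} (σ τ : Fin m → ℕ) : dH σ τ = dH τ σ := by
  simp only [dH, abs_sub_comm]

theorem dH_triangle {m : ℕ} (σ τ ρ : Fin m → ℕ) : dH σ ρ ≤ dH σ τ + dH τ ρ := by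
  simp only [dH, ← mul_add, ← Finset.sum_add_distrib]
  gcongr
  exact abs_sub_le _ _ _

/-- The head-to-head distance is additive along coordinatewise betweenness. -/
theorem dH_add_of_between {m : ℕ} {σ τ ρ : Fin m → ℕ}
    (h : ∀ i j, (hcoord σ i j ≤ hcoord τ i j ∧ hcoord τ i j ≤ hcoord ρ i j) ∨
      (hcoord ρ i j ≤ hcoord τ i j ∧ hcoord τ i j ≤ hcoord σ i j)) :
    dH σ τ + dH τ ρ = dH σ ρ := by
  simp only [dH, ← mul_add, ← Finset.sum_add_distrib]
  congr 1
  refine Finset.sum_congr rfl fun p _ => ?_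
  rcases h p.1 p.2 with ⟨h₁, h₂⟩ | ⟨h₁, h₂⟩
  · rw [abs_of_nonpos (by linarith), abs_of_nonpos (by linarith), abs_of_nonpos (by linarith)]
    ring
  · rw [abs_of_nonneg (by linarith), abs_of_nonneg (by linarith), abs_of_nonneg (by linarith)]
    ring

/-- The head-to-head distance as a sum over all ordered pairs. -/
theorem dH_eq_sum {m : ℕ} (σ τ : Fin m → ℕ) :
    dH σ τ = (1 / 4) * ∑ i, ∑ j, |hcoord σ i j - hcoord τ i j| := by
  set f : Fin m → Fin m → ℝ := fun i j => |hcoord σ i j - hcoord τ i j| with hf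
  have hsymm : ∀ i j, f i j = f j i := fun i j => by
    simp only [hf]
    rw [hcoord_swap σ j i, hcoord_swap τ j i, ← abs_neg]
    ring_nf
  have hdiag : ∀ i, f i i = 0 := fun i => by simp [hf, hcoord]
  have hlt : ∑ p ∈ Finset.univ.filter (fun p : Fin m × Fin m => p.1 < p.2), f p.1 p.2
      = ∑ i, ∑ j, if i < j then f i j else 0 := by
    rw [Finset.sum_filter, Fintype.sum_prod_type]
  have hgt : ∑ i, ∑ j, (if i < j then f i j else 0) = ∑ i, ∑ j, if j < i then f i j else 0 := by
    rw [Finset.sum_comm]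
    simp only [hsymm]
  have hsplit : ∑ i, ∑ j, f i j
      = ∑ i, ∑ j, (if i < j then f i j else 0) + ∑ i, ∑ j, if j < i then f i j else 0 := by
    simp only [← Finset.sum_add_distrib]
    refine Finset.sum_congr rfl fun i _ => Finset.sum_congr rfl fun j _ => ?_
    rcases lt_trichotomy i j with h | h | h
    · simp [h, h.not_gt]
    · simp [h, hdiag]
    · simp [h, h.not_gt]
  change (1 / 2) * ∑ p ∈ Finset.univ.filter (fun p : Fin m × Fin m => p.1 < p.2), f p.1 p.2
      = (1 / 4) * ∑ i, ∑ j, f i j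
  rw [hsplit, ← hgt, hlt]
  ring

/-- The rank of an untied candidate is one more than the number of candidates ahead of it. -/
theorem IsBallot.card_lt {m : ℕ} {σ : Fin m → ℕ} (hσ : IsBallot m σ) (i : Fin m)
    (hi : ∀ j, σ j = σ i → j = i) :
    (Finset.univ.filter fun j => σ j < σ i).card + 1 = σ i := by
  obtain ⟨hr, hinj, hsurj⟩ := hσ
  rcases (hr i).2.lt_or_eq with h | h
  · have himg : (Finset.univ.filter fun j => σ j < σ i).image σ = Finset.Ico 1 (σ i) := by
      ext r
      simp only [Finset.mem_image, Finset.mem_filter, Finset.mem_univ, true_and, Finset.mem_Ico]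
      constructor
      · rintro ⟨j, hj, rfl⟩
        exact ⟨(hr j).1, hj⟩
      · rintro ⟨h₁, h₂⟩
        obtain ⟨j, rfl⟩ := hsurj i r h₁ h₂.le h
        exact ⟨j, h₂, rfl⟩
    have hcard := congrArg Finset.card himg
    rw [Finset.card_image_of_injOn, Nat.card_Ico] at hcard
    · have := (hr i).1
      omega
    · intro j hj j' _ hjj'
      simp only [Finset.coe_filter, Finset.mem_univ, true_and, Set.mem_ofPred_eq] at hj
      exact hinj j j' (hj.trans h) hjj'
  · have heq : (Finset.univ.filter fun j => σ j < σ i) = Finset.univ.erase i := by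
      ext j
      simp only [Finset.mem_filter, Finset.mem_univ, true_and, Finset.mem_erase, and_true]
      constructor
      · rintro hj rfl
        exact lt_irrefl _ hj
      · intro hj
        exact h ▸ (hr j).2.lt_of_ne fun h' => hj (hi j (h'.trans h.symm))
    rw [heq, Finset.card_erase_of_mem (Finset.mem_univ i), Finset.card_univ, Fintype.card_fin]
    have := i.pos
    omega

/-- A ballot is determined by its strict order and its ties. -/
theorem IsBallot.eq_of_order {m : ℕ} {σ τ : Fin m → ℕ} (hσ : IsBallot m σ) (hτ : IsBallot m τ)
    (hlt : ∀ i j, σ i < σ j → τ i < τ j) (heq : ∀ i j, σ i = σ j → τ i = τ j) : σ = τ := by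
  have hlt' : ∀ i j, τ i < τ j ↔ σ i < σ j := fun i j => by
    refine ⟨fun h => ?_, hlt i j⟩
    rcases lt_trichotomy (σ i) (σ j) with h' | h' | h'
    · exact h'
    · exact absurd (heq i j h') h.ne
    · exact absurd (hlt j i h') h.not_gt
  funext i
  by_cases hi : ∀ j, σ j = σ i → j = i
  · have hi' : ∀ j, τ j = τ i → j = i := fun j hj => by
      refine hi j (le_antisymm ?_ ?_)
      · exact not_lt.1 fun h => (hlt i j h).ne' hj
      · exact not_lt.1 fun h => (hlt j i h).ne hj
    rw [← hσ.card_lt i hi, ← hτ.card_lt i hi']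
    simp only [hlt']
  · push Not at hi
    obtain ⟨j, hj, hne⟩ := hi
    have top : ∀ {ρ : Fin m → ℕ}, IsBallot m ρ → ρ j = ρ i → ρ i = m := fun hρ h =>
      ((hρ.1 i).2.eq_or_lt).resolve_right fun hl => hne (hρ.2.1 i j hl h.symm).symm
    rw [top hσ hj, top hτ (heq j i hj)]

theorem SwapAdj.dH_eq_one {m : ℕ} {σ τ : Ballot m} (h : SwapAdj m σ τ) : dH σ.1 τ.1 = 1 := by
  obtain ⟨a, b, hab, hs, hb, hτa, hτb, hτ⟩ := h
  have hinj := σ.2.2.1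
  have hr := σ.2.1
  have hna : ∀ c, c ≠ a → σ.1 c ≠ σ.1 a := fun c hc h =>
    hc (hinj a c (by have := (hr b).2; omega) h.symm).symm
  have hnb : ∀ c, c ≠ b → σ.1 c ≠ σ.1 b := fun c hc h => by
    rcases (hr b).2.lt_or_eq with h' | h'
    · exact hc (hinj b c h' h.symm).symm
    · exact hc ((hb.resolve_left (by omega)) c (h.trans h'))
  have key : ∀ i j, |hcoord σ.1 i j - hcoord τ.1 i j|
      = 2 * (if i = a then if j = b then 1 else 0 else 0)
        + 2 * (if i = b then if j = a then 1 else 0 else 0) := by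
    intro i j
    unfold hcoord
    by_cases hia : i = a
    · subst hia
      by_cases hji : j = i
      · subst hji; simp [hab]
      by_cases hjb : j = b
      · subst hjb; simp [hτa, hτb, hs, hab]; norm_num
      have := hna j hji
      have := hnb j hjb
      simp only [hτa, hτ j hji hjb, hab, hjb, if_true, if_false]
      split_ifs <;> first | omega | norm_num
    by_cases hib : i = b
    · subst hib
      by_cases hji : j = i
      · subst hji; simp [hia]
      by_cases hja : j = a
      · subst hja; simp [hτa, hτb, hs, hia]; norm_num
      have := hna j hja
      have := hnb j hji
      simp only [hτb, hτ j hja hji, hia, hja, if_true, if_false]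
      split_ifs <;> first | omega | norm_num
    have h₁ := hna i hia
    have h₂ := hnb i hib
    by_cases hja : j = a
    · subst hja
      simp only [hτa, hτ i hia hib, hia, hib, if_false]
      split_ifs <;> first | omega | norm_num
    by_cases hjb : j = b
    · subst hjb
      simp only [hτb, hτ i hia hib, hia, hib, if_false]
      split_ifs <;> first | omega | norm_num
    simp [hτ i hia hib, hτ j hja hjb, hia, hib]
  rw [dH_eq_sum]
  simp only [key, Finset.sum_add_distrib, ← Finset.mul_sum]
  simp
  norm_num

theorem dH_extension {m : ℕ} {σ τ : Ballot m} {c : Fin m} (hσc : σ.1 c = m) (hτc : τ.1 c < m)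
    (hτ : ∀ i, i ≠ c → τ.1 i = σ.1 i) : dH σ.1 τ.1 = ((m : ℝ) - τ.1 c) / 2 := by
  have hr := σ.2.1
  have hne : ∀ i, i ≠ c → σ.1 i ≠ τ.1 c := fun i hi h =>
    hi (τ.2.2.1 c i hτc (by rw [hτ i hi, h])).symm
  have hlt : ∀ i, i ≠ c → σ.1 i < m → σ.1 i < τ.1 c := fun i hi h => by
    by_contra hcon
    obtain ⟨j, hj⟩ := σ.2.2.2 i (τ.1 c) (τ.2.1 c).1 (not_lt.1 hcon) h
    by_cases hjc : j = c
    · subst hjc; omega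
    · exact hne j hjc hj
  have hcases : ∀ i, i ≠ c → σ.1 i < τ.1 c ∨ σ.1 i = m := fun i hi => by
    rcases (hr i).2.lt_or_eq with h | h
    · exact Or.inl (hlt i hi h)
    · exact Or.inr h
  have key : ∀ i j, |hcoord σ.1 i j - hcoord τ.1 i j|
      = (if i = c then if τ.1 c < τ.1 j then 1 else 0 else 0)
        + (if j = c then if τ.1 c < τ.1 i then 1 else 0 else 0) := by
    intro i j
    unfold hcoord
    by_cases hi : i = c
    · subst hi
      by_cases hj : j = i
      · subst hj; simp
      have := hcases j hj
      simp only [hτ j hj, hσc, hj, if_true, if_false]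
      split_ifs <;> first | omega | norm_num
    by_cases hj : j = c
    · subst hj
      have := hcases i hi
      simp only [hτ i hi, hσc, hi, if_true, if_false]
      split_ifs <;> first | omega | norm_num
    simp [hτ i hi, hτ j hj, hi, hj]
  have hcard : (Finset.univ.filter fun j => τ.1 c < τ.1 j).card + τ.1 c = m := by
    have h₁ := τ.2.card_lt c fun j hj => (τ.2.2.1 c j hτc hj.symm).symm
    have h₂ : (Finset.univ.filter fun j => ¬ τ.1 c < τ.1 j)
        = insert c (Finset.univ.filter fun j => τ.1 j < τ.1 c) := by
      ext j
      simp only [Finset.mem_filter, Finset.mem_univ, true_and, Finset.mem_insert, not_lt]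
      constructor
      · intro h
        rcases h.lt_or_eq with h' | h'
        · exact Or.inr h'
        · exact Or.inl (τ.2.2.1 c j hτc h'.symm).symm
      · rintro (rfl | h)
        · exact le_rfl
        · exact h.le
    have h₃ := Finset.card_filter_add_card_filter_not (s := (Finset.univ : Finset (Fin m)))
      (fun j => τ.1 c < τ.1 j)
    rw [h₂, Finset.card_insert_of_notMem (by simp), h₁] at h₃
    simpa using h₃
  have hcard' : ((Finset.univ.filter fun j => τ.1 c < τ.1 j).card : ℝ) = m - τ.1 c := by
    rw [eq_sub_iff_add_eq]
    exact_mod_cast hcard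
  rw [dH_eq_sum]
  simp only [key, Finset.sum_add_distrib]
  simp only [Finset.sum_ite_eq', Finset.mem_univ, if_true, Finset.sum_ite_irrel,
    Finset.sum_const_zero, Finset.sum_boole, hcard']
  ring

theorem BallotAdjW.dH_eq {m : ℕ} {σ τ : Ballot m} {w : ℝ} (h : BallotAdjW m σ τ w) :
    dH σ.1 τ.1 = w := by
  rcases h with ⟨h, rfl⟩ | ⟨c, h₁, h₂, h₃, rfl⟩ | ⟨c, h₁, h₂, h₃, rfl⟩
  · exact h.dH_eq_one
  · exact dH_extension h₁ h₂ h₃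
  · rw [dH_comm]
    exact dH_extension h₁ h₂ h₃

theorem BallotAdjW.half_le {m : ℕ} {σ τ : Ballot m} {w : ℝ} (h : BallotAdjW m σ τ w) :
    1 / 2 ≤ w := by
  have aux : ∀ {k : ℕ}, k < m → (1 / 2 : ℝ) ≤ ((m : ℝ) - k) / 2 := fun {k} hk => by
    have : (k : ℝ) + 1 ≤ m := by exact_mod_cast hk
    linarith
  rcases h with ⟨_, rfl⟩ | ⟨c, _, h, _, rfl⟩ | ⟨c, _, h, _, rfl⟩
  · norm_num
  · exact aux h
  · exact aux h

theorem BallotReach.dH_le {m : ℕ} {σ τ : Ballot m} {c : ℝ} (h : BallotReach m σ τ c) :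
    dH σ.1 τ.1 ≤ c := by
  induction h with
  | refl σ => exact (dH_self σ.1).le
  | @step σ τ ρ w c hadj _ ih =>
    have := dH_triangle σ.1 τ.1 ρ.1
    rw [hadj.dH_eq] at this
    linarith

/-- If two candidates are unlisted, there is a first vacant position before the last one. -/
theorem IsBallot.exists_next_rank {m : ℕ} {σ : Fin m → ℕ} (hσ : IsBallot m σ) {x y : Fin m}
    (hxy : x ≠ y) (hx : σ x = m) (hy : σ y = m) :
    ∃ r, 1 ≤ r ∧ r < m ∧ (∀ i, σ i < m → σ i < r) ∧ ∀ j, 1 ≤ j → j < r → ∃ i, σ i = j := by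
  classical
  have hex : ∃ r, 1 ≤ r ∧ r < m ∧ ∀ i, σ i ≠ r := by
    by_contra! hcon
    have hsub : Finset.Icc 1 m ⊆ (Finset.univ.erase x).image σ := by
      intro r hr
      rw [Finset.mem_Icc] at hr
      rcases hr.2.lt_or_eq with h | h
      · obtain ⟨i, hi⟩ := hcon r hr.1 h
        refine Finset.mem_image.2 ⟨i, Finset.mem_erase.2 ⟨?_, Finset.mem_univ i⟩, hi⟩
        rintro rfl
        omega
      · exact Finset.mem_image.2 ⟨y, Finset.mem_erase.2 ⟨hxy.symm, Finset.mem_univ y⟩,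
          hy.trans h.symm⟩
    have h₁ := (Finset.card_le_card hsub).trans Finset.card_image_le
    rw [Nat.card_Icc, Finset.card_erase_of_mem (Finset.mem_univ x), Finset.card_univ,
      Fintype.card_fin] at h₁
    have := x.pos
    omega
  obtain ⟨h₁, h₂, h₃⟩ := Nat.find_spec hex
  refine ⟨Nat.find hex, h₁, h₂, fun i hi => ?_, fun j hj hjr => ?_⟩
  · by_contra! hcon
    obtain ⟨i', hi'⟩ := hσ.2.2 i _ h₁ hcon hi
    exact h₃ i' hi'
  · have := Nat.find_min hex hjr
    push Not at this
    exact this hj (hjr.trans h₂)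

/-- Listing next the `τ`-best among the candidates unlisted by `σ` moves `σ` towards `τ`. -/
theorem exists_extension_towards {m : ℕ} (σ τ : Ballot m) {x y : Fin m} (hxy : x ≠ y)
    (hx : σ.1 x = m) (hy : σ.1 y = m) (hτx : τ.1 x < m) :
    ∃ σ' w, BallotAdjW m σ σ' w ∧ dH σ.1 σ'.1 + dH σ'.1 τ.1 = dH σ.1 τ.1 := by
  obtain ⟨r, hr₁, hrm, hlt, hsurj⟩ := σ.2.exists_next_rank hxy hx hy
  obtain ⟨c, hc, hmin⟩ := (Finset.univ.filter fun i => σ.1 i = m).exists_min_image τ.1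
    ⟨x, by simpa using hx⟩
  simp only [Finset.mem_filter, Finset.mem_univ, true_and] at hc hmin
  have hτc : τ.1 c < m := (hmin x hx).trans_lt hτx
  have hother : ∀ i, i ≠ c → Function.update σ.1 c r i = σ.1 i := fun i hi => by simp [hi]
  have hself : Function.update σ.1 c r c = r := by simp
  have hcases : ∀ i, i ≠ c → σ.1 i < r ∨ (σ.1 i = m ∧ τ.1 c < τ.1 i) := fun i hi => by
    rcases (σ.2.1 i).2.lt_or_eq with h | h
    · exact Or.inl (hlt i h)
    · exact Or.inr ⟨h, (hmin i h).lt_of_ne fun h' => hi (τ.2.2.1 c i hτc h').symm⟩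
  have hballot : IsBallot m (Function.update σ.1 c r) := by
    refine ⟨fun i => ?_, fun i i' hi hii' => ?_, fun i j hj hji hi => ?_⟩
    · by_cases hic : i = c
      · subst hic; rw [hself]; omega
      · rw [hother i hic]; exact σ.2.1 i
    · by_cases hic : i = c
      · by_cases hic' : i' = c
        · rw [hic, hic']
        · rw [hic, hself, hother i' hic'] at hii'
          have := hcases i' hic'
          omega
      · rw [hother i hic] at hi hii'
        by_cases hic' : i' = c
        · rw [hic', hself] at hii'
          have := hcases i hic
          omega
        · rw [hother i' hic'] at hii'
          exact σ.2.2.1 i i' hi hii'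
    · have hjr : j ≤ r := by
        by_cases hic : i = c
        · rwa [hic, hself] at hji
        · rw [hother i hic] at hji hi
          have := hlt i hi
          omega
      rcases hjr.lt_or_eq with h | h
      · obtain ⟨i', hi'⟩ := hsurj j hj h
        refine ⟨i', ?_⟩
        rw [hother i' (by rintro rfl; omega), hi']
      · exact ⟨c, hself.trans h.symm⟩
  refine ⟨⟨_, hballot⟩, _, Or.inr (Or.inl ⟨c, hc, by simpa using hrm, hother, rfl⟩), ?_⟩
  refine dH_add_of_between fun i j => ?_
  unfold hcoord
  by_cases hi : i = c
  · subst hi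
    by_cases hj : j = i
    · subst hj; simp
    have := hcases j hj
    simp only [hother j hj, hself, hc]
    split_ifs <;> first | omega | norm_num
  by_cases hj : j = c
  · subst hj
    have := hcases i hi
    simp only [hother i hi, hself, hc]
    split_ifs <;> first | omega | norm_num
  simp only [hother i hi, hother j hj]
  exact (le_total _ _).imp (fun h => ⟨le_rfl, h⟩) (fun h => ⟨h, le_rfl⟩)

/-- Swapping neighbors of `σ` that `τ` ranks in the opposite order moves `σ` towards `τ`. -/
theorem exists_swap_towards {m : ℕ} (σ τ : Ballot m) {a b : Fin m} (hs : σ.1 b = σ.1 a + 1)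
    (hb : σ.1 b < m ∨ ∀ c, σ.1 c = m → c = b) (hτ : τ.1 b < τ.1 a) :
    ∃ σ' w, BallotAdjW m σ σ' w ∧ dH σ.1 σ'.1 + dH σ'.1 τ.1 = dH σ.1 τ.1 := by
  have hab : a ≠ b := by rintro rfl; omega
  have hr := σ.2.1
  have hna : ∀ c, c ≠ a → σ.1 c ≠ σ.1 a := fun c hc h =>
    hc (σ.2.2.1 a c (by have := (hr b).2; omega) h.symm).symm
  have hnb : ∀ c, c ≠ b → σ.1 c ≠ σ.1 b := fun c hc h => by
    rcases (hr b).2.lt_or_eq with h' | h'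
    · exact hc (σ.2.2.1 b c h' h.symm).symm
    · exact hc ((hb.resolve_left (by omega)) c (h.trans h'))
  have hballot : IsBallot m (fun i => σ.1 (Equiv.swap a b i)) := by
    refine ⟨fun i => σ.2.1 _, fun i i' hi hii' => ?_, fun i j hj hji hi => ?_⟩
    · exact (Equiv.swap a b).injective (σ.2.2.1 _ _ hi hii')
    · obtain ⟨i', hi'⟩ := σ.2.2.2 _ j hj hji hi
      exact ⟨Equiv.swap a b i', by simpa using hi'⟩
  have hA : σ.1 (Equiv.swap a b a) = σ.1 b := by simp
  have hB : σ.1 (Equiv.swap a b b) = σ.1 a := by simp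
  have hother : ∀ c, c ≠ a → c ≠ b → σ.1 (Equiv.swap a b c) = σ.1 c := fun c h₁ h₂ => by
    rw [Equiv.swap_apply_of_ne_of_ne h₁ h₂]
  refine ⟨⟨_, hballot⟩, 1, Or.inl ⟨⟨a, b, hab, hs, hb, hA, hB, hother⟩, rfl⟩, ?_⟩
  refine dH_add_of_between fun i j => ?_
  have hsame : hcoord (fun i => σ.1 (Equiv.swap a b i)) i j = hcoord σ.1 i j →
      (hcoord σ.1 i j ≤ hcoord (fun i => σ.1 (Equiv.swap a b i)) i j ∧
        hcoord (fun i => σ.1 (Equiv.swap a b i)) i j ≤ hcoord τ.1 i j) ∨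
      (hcoord τ.1 i j ≤ hcoord (fun i => σ.1 (Equiv.swap a b i)) i j ∧
        hcoord (fun i => σ.1 (Equiv.swap a b i)) i j ≤ hcoord σ.1 i j) := fun h => by
    rw [h]
    exact (le_total _ _).imp (fun h => ⟨le_rfl, h⟩) (fun h => ⟨h, le_rfl⟩)
  by_cases hia : i = a
  · subst hia
    by_cases hji : j = i
    · subst hji; simp [hcoord]
    by_cases hjb : j = b
    · subst hjb
      simp only [hcoord, hA, hB]
      split_ifs <;> first | omega | norm_num
    have := hna j hji
    have := hnb j hjb
    refine hsame ?_
    simp only [hcoord, hA, hother j hji hjb]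
    split_ifs <;> first | omega | norm_num
  by_cases hib : i = b
  · subst hib
    by_cases hji : j = i
    · subst hji; simp [hcoord]
    by_cases hja : j = a
    · subst hja
      simp only [hcoord, hA, hB]
      split_ifs <;> first | omega | norm_num
    have := hna j hja
    have := hnb j hji
    refine hsame ?_
    simp only [hcoord, hB, hother j hja hji]
    split_ifs <;> first | omega | norm_num
  have h₁ := hna i hia
  have h₂ := hnb i hib
  refine hsame ?_
  by_cases hja : j = a
  · subst hja
    simp only [hcoord, hA, hother i hia hib]
    split_ifs <;> first | omega | norm_num
  by_cases hjb : j = b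
  · subst hjb
    simp only [hcoord, hB, hother i hia hib]
    split_ifs <;> first | omega | norm_num
  simp only [hcoord, hother i hia hib, hother j hja hjb]

/-- Dropping the last listed candidate of `σ`, when unlisted by `τ`, moves `σ` towards `τ`. -/
theorem exists_removal_towards {m : ℕ} (σ τ : Ballot m) {c : Fin m} (hc : σ.1 c < m)
    (hmax : ∀ i, σ.1 i < m → σ.1 i ≤ σ.1 c) (hτc : τ.1 c = m) :
    ∃ σ' w, BallotAdjW m σ σ' w ∧ dH σ.1 σ'.1 + dH σ'.1 τ.1 = dH σ.1 τ.1 := by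
  have hother : ∀ i, i ≠ c → Function.update σ.1 c m i = σ.1 i := fun i hi => by simp [hi]
  have hself : Function.update σ.1 c m c = m := by simp
  have hcases : ∀ i, i ≠ c → σ.1 i < σ.1 c ∨ σ.1 i = m := fun i hi => by
    rcases (σ.2.1 i).2.lt_or_eq with h | h
    · exact Or.inl ((hmax i h).lt_of_ne fun h' => hi (σ.2.2.1 i c h h'))
    · exact Or.inr h
  have hballot : IsBallot m (Function.update σ.1 c m) := by
    refine ⟨fun i => ?_, fun i i' hi hii' => ?_, fun i j hj hji hi => ?_⟩
    · by_cases hic : i = c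
      · subst hic
        rw [hself]
        exact ⟨i.pos, le_rfl⟩
      · rw [hother i hic]; exact σ.2.1 i
    · have hic : i ≠ c := by rintro rfl; omega
      have hic' : i' ≠ c := by rintro rfl; omega
      rw [hother i hic] at hi hii'
      rw [hother i' hic'] at hii'
      exact σ.2.2.1 i i' hi hii'
    · have hic : i ≠ c := by rintro rfl; omega
      rw [hother i hic] at hi hji
      obtain ⟨i', hi'⟩ := σ.2.2.2 i j hj hji hi
      refine ⟨i', ?_⟩
      have := hcases i hic
      rw [hother i' (by rintro rfl; omega), hi']
  refine ⟨⟨_, hballot⟩, _, Or.inr (Or.inr ⟨c, hself, hc, fun i hi => (hother i hi).symm, rfl⟩), ?_⟩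
  refine dH_add_of_between fun i j => ?_
  have hτle := fun i => (τ.2.1 i).2
  unfold hcoord
  by_cases hi : i = c
  · subst hi
    by_cases hj : j = i
    · subst hj; simp
    have := hcases j hj
    have := hτle j
    simp only [hother j hj, hself, hτc]
    split_ifs <;> first | omega | norm_num
  by_cases hj : j = c
  · subst hj
    have := hcases i hi
    have := hτle i
    simp only [hother i hi, hself, hτc]
    split_ifs <;> first | omega | norm_num
  simp only [hother i hi, hother j hj]
  exact (le_total _ _).imp (fun h => ⟨le_rfl, h⟩) (fun h => ⟨h, le_rfl⟩)

/-- Monotonicity on neighboring positions propagates to all positions that are not tied. -/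
theorem IsBallot.monotone_of_neighbors {m : ℕ} {σ τ : Fin m → ℕ} (hσ : IsBallot m σ)
    (h : ∀ a b, σ b = σ a + 1 → (σ b < m ∨ ∀ c, σ c = m → c = b) → τ a ≤ τ b) (i : Fin m) :
    ∀ n j, σ j = σ i + 1 + n → (σ j < m ∨ ∀ c, σ c = m → c = j) → τ i ≤ τ j := by
  intro n
  induction n with
  | zero => exact fun j => h i j
  | succ n ih =>
    intro j hj hjm
    have hjle := (hσ.1 j).2
    have hpred : ∃ k, σ k = σ i + 1 + n := by
      rcases hjle.lt_or_eq with hl | he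
      · exact hσ.2.2 j _ (by omega) (by omega) hl
      · have huniq := hjm.resolve_left (by omega)
        have hcard := hσ.card_lt j fun k hk => huniq k (hk.trans he)
        by_contra! hcon
        have hlt : ∀ k, k ≠ j → σ k < σ i + 1 + n := fun k hk => by
          by_contra! hge
          have hkm : σ k < m := (hσ.1 k).2.lt_of_ne fun h' => hk (huniq k h')
          obtain ⟨l, hl⟩ := hσ.2.2 k (σ i + 1 + n) (by omega) hge hkm
          exact hcon l hl
        have hsub : (Finset.univ.filter fun k => σ k < σ j).card
            ≤ (Finset.Ico 1 (σ i + 1 + n)).card := by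
          refine Finset.card_le_card_of_injOn σ (fun k hk => ?_) fun k hk l _ hkl => ?_
          · simp only [Finset.coe_filter, Finset.mem_univ, true_and, Set.mem_ofPred_eq] at hk
            simp only [Finset.coe_Ico, Set.mem_Ico]
            exact ⟨(hσ.1 k).1, hlt k (by rintro rfl; omega)⟩
          · simp only [Finset.coe_filter, Finset.mem_univ, true_and, Set.mem_ofPred_eq] at hk
            exact hσ.2.1 k l (by omega) hkl
        rw [Nat.card_Ico] at hsub
        omega
    obtain ⟨k, hk⟩ := hpred
    exact (ih k hk (Or.inl (by omega))).trans (h k j (by omega) hjm)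

/-- From a ballot there is an edge along a geodesic to any other ballot. -/
theorem exists_adj_towards {m : ℕ} {σ τ : Ballot m} (hne : σ ≠ τ) :
    ∃ σ' w, BallotAdjW m σ σ' w ∧ dH σ.1 σ'.1 + dH σ'.1 τ.1 = dH σ.1 τ.1 := by
  by_contra hcon
  refine hne (Subtype.ext ?_)
  have htie : ∀ x y, x ≠ y → σ.1 x = m → σ.1 y = m → τ.1 x = m := fun x y hxy hx hy =>
    (τ.2.1 x).2.eq_or_lt.resolve_right fun h =>
      hcon (exists_extension_towards σ τ hxy hx hy h)
  have hmono := σ.2.monotone_of_neighbors (τ := τ.1) fun a b hs hb =>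
    not_lt.1 fun h => hcon (exists_swap_towards σ τ hs hb h)
  have hlisted : ∀ i, σ.1 i < m → τ.1 i < m := by
    intro i hi
    obtain ⟨c, hc, hmax⟩ := (Finset.univ.filter fun i => σ.1 i < m).exists_max_image σ.1
      ⟨i, by simpa using hi⟩
    simp only [Finset.mem_filter, Finset.mem_univ, true_and] at hc hmax
    have hτc : τ.1 c < m := (τ.2.1 c).2.lt_of_ne fun h =>
      hcon (exists_removal_towards σ τ hc hmax h)
    rcases (hmax i hi).lt_or_eq with h | h
    · exact (hmono i (σ.1 c - (σ.1 i + 1)) c (by omega) (Or.inl hc)).trans_lt hτc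
    · rwa [σ.2.2.1 i c hi h]
  refine σ.2.eq_of_order τ.2 (fun i j hij => ?_) (fun i j hij => ?_)
  · have hi : σ.1 i < m := hij.trans_le (σ.2.1 j).2
    by_cases hj : σ.1 j < m ∨ ∀ c, σ.1 c = m → c = j
    · refine (hmono i (σ.1 j - (σ.1 i + 1)) j (by omega) hj).lt_of_ne fun h => ?_
      have := τ.2.2.1 i j (hlisted i hi) h
      subst this
      exact lt_irrefl _ hij
    · push Not at hj
      obtain ⟨hjm, c, hc, hcj⟩ := hj
      rw [htie j c hcj.symm (le_antisymm (σ.2.1 j).2 hjm) hc]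
      exact hlisted i hi
  · by_cases h : i = j
    · rw [h]
    · have hi : σ.1 i = m := (σ.2.1 i).2.eq_or_lt.resolve_right fun hl =>
        h (σ.2.2.1 i j hl hij)
      rw [htie i j h hi (hij ▸ hi), htie j i (Ne.symm h) (hij ▸ hi) hi]

/-- Some edge-path realizes the head-to-head distance. -/
theorem ballotReach_dH {m : ℕ} (σ τ : Ballot m) : BallotReach m σ τ (dH σ.1 τ.1) := by
  obtain ⟨n, hn⟩ := exists_nat_ge (2 * dH σ.1 τ.1)
  induction n generalizing σ with
  | zero =>
    by_cases hne : σ = τ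
    · subst hne
      rw [dH_self]
      exact .refl _
    · obtain ⟨σ', w, hadj, hsum⟩ := exists_adj_towards hne
      have := hadj.half_le
      have := dH_nonneg σ'.1 τ.1
      rw [hadj.dH_eq] at hsum
      push_cast at hn
      linarith
  | succ n ih =>
    by_cases hne : σ = τ
    · subst hne
      rw [dH_self]
      exact .refl _
    · obtain ⟨σ', w, hadj, hsum⟩ := exists_adj_towards hne
      have := hadj.half_le
      rw [hadj.dH_eq] at hsum
      push_cast at hn
      rw [← hsum]
      exact .step hadj (ih σ' (by linarith))

/-- For all partial ballots `σ, τ` on `m` candidates, the path-metric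
distance between `σ` and `τ` in the ballot graph `𝒢_m` equals `d_H(σ,τ)`. -/
theorem ballotGraphDist_eq_dH (m : ℕ) (σ τ : Ballot m) :
    ballotGraphDist m σ τ = dH σ.1 τ.1 := by
  have hleast : IsLeast {c : ℝ | BallotReach m σ τ c} (dH σ.1 τ.1) :=
    ⟨ballotReach_dH σ τ, fun _ hc => BallotReach.dH_le hc⟩
  exact hleast.csInf_eq
end

section
/- For all partial ballots σ, τ on m candidates, (1/2)·str(σ,τ) + (1/2)·wk(σ,τ) ≤ d_B(σ,τ) ≤ str(σ,τ) + (1/2)·wk(σ,τ) = d_H(σ,τ); moreover the first inequality is strict whenever str(σ,τ) > 0. -/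
/-- The pair `i, j` is strictly ranked in opposite orders by `σ` and `τ`. -/
abbrev StrongDis {m : ℕ} (σ τ : Fin m → ℕ) (i j : Fin m) : Prop :=
  (σ i < σ j ∧ τ j < τ i) ∨ (σ j < σ i ∧ τ i < τ j)

/-- The pair `i, j` is tied by exactly one of `σ` and `τ`. -/
abbrev WeakDis {m : ℕ} (σ τ : Fin m → ℕ) (i j : Fin m) : Prop :=
  (σ i = σ j ∧ τ i ≠ τ j) ∨ (σ i ≠ σ j ∧ τ i = τ j)

/-- The charge that the pair `i, j` puts on the candidate `i`: it is `1` when one ballot ranks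
`j` after `i` but no later than the position of `i` in the other ballot. -/
def charge {m : ℕ} (σ τ : Fin m → ℕ) (i j : Fin m) : ℤ :=
  (if τ i < τ j ∧ τ j ≤ σ i then 1 else 0) + (if σ i < σ j ∧ σ j ≤ τ i then 1 else 0)

theorem sum_sum_eq_sum_lt {m : ℕ} (f : Fin m → Fin m → ℤ) (hf : ∀ i, f i i = 0) :
    ∑ i, ∑ j, f i j = ∑ p ∈ Finset.univ.filter (fun p : Fin m × Fin m => p.1 < p.2),
      (f p.1 p.2 + f p.2 p.1) := by
  have hsplit (i j : Fin m) :
      f i j = (if i < j then f i j else 0) + (if j < i then f i j else 0) := by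
    rcases lt_trichotomy i j with h | rfl | h
    · simp [h, h.not_gt]
    · simp [hf]
    · simp [h, h.not_gt]
  rw [Finset.sum_filter, Fintype.sum_prod_type]
  simp_rw [ite_add_zero, Finset.sum_add_distrib]
  conv_lhs => enter [2, i, 2, j]; rw [hsplit]
  simp_rw [Finset.sum_add_distrib]
  congr 1
  exact Finset.sum_comm

theorem strDis_eq_sum {m : ℕ} (σ τ : Fin m → ℕ) :
    (strDis σ τ : ℤ) = ∑ p ∈ Finset.univ.filter (fun p : Fin m × Fin m => p.1 < p.2),
      if StrongDis σ τ p.1 p.2 then 1 else 0 := by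
  rw [strDis, ← Finset.filter_filter, Finset.sum_boole]

theorem wkDis_eq_sum {m : ℕ} (σ τ : Fin m → ℕ) :
    (wkDis σ τ : ℤ) = ∑ p ∈ Finset.univ.filter (fun p : Fin m × Fin m => p.1 < p.2),
      if WeakDis σ τ p.1 p.2 then 1 else 0 := by
  rw [wkDis, ← Finset.filter_filter, Finset.sum_boole]

theorem dB_eq_sum {m : ℕ} (σ τ : Fin m → ℕ) :
    dB m σ τ = (1 / 2) * ((∑ i, |(σ i : ℤ) - τ i| : ℤ) : ℝ) := by
  unfold dB bordaEmb
  push_cast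
  congr 1
  refine Finset.sum_congr rfl fun i _ => ?_
  rw [abs_sub_comm]
  congr 1
  ring

theorem str_add_half_wk_eq_dH {m : ℕ} (σ τ : Fin m → ℕ) :
    (strDis σ τ : ℝ) + (1 / 2) * (wkDis σ τ : ℝ) = dH σ τ := by
  have hs : (strDis σ τ : ℝ) = ((strDis σ τ : ℤ) : ℝ) := by simp
  have hw : (wkDis σ τ : ℝ) = ((wkDis σ τ : ℤ) : ℝ) := by simp
  rw [hs, hw, strDis_eq_sum, wkDis_eq_sum, dH]
  push_cast
  rw [Finset.mul_sum, Finset.mul_sum, ← Finset.sum_add_distrib]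
  refine Finset.sum_congr rfl fun p _ => ?_
  unfold hcoord StrongDis WeakDis
  split_ifs <;> first | omega | norm_num

namespace IsBallot

variable {m : ℕ} {σ τ : Fin m → ℕ}

theorem card_le (hσ : IsBallot m σ) {t : ℕ} (ht : t ≤ m) :
    (Finset.univ.filter fun j => σ j ≤ t).card ≤ t := by
  rcases ht.eq_or_lt with rfl | ht
  · exact (Finset.card_filter_le _ _).trans (by simp)
  · calc (Finset.univ.filter fun j => σ j ≤ t).card ≤ (Finset.Icc 1 t).card := by
          refine Finset.card_le_card_of_injOn σ (fun j hj => ?_) fun i hi j _ hij => ?_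
          · simp only [Finset.coe_filter, Finset.mem_univ, true_and, Set.mem_ofPred_eq] at hj
            simpa using ⟨(hσ.1 j).1, hj⟩
          · simp only [Finset.coe_filter, Finset.mem_univ, true_and, Set.mem_ofPred_eq] at hi
            exact hσ.2.1 i j (by omega) hij
      _ = t := by simp

/-- A rank counts the candidates placed weakly above it. -/
theorem card_eq (hσ : IsBallot m σ) (i : Fin m) :
    (Finset.univ.filter fun j => σ j ≤ σ i).card = σ i := by
  refine le_antisymm (hσ.card_le (hσ.1 i).2) ?_
  rcases (hσ.1 i).2.eq_or_lt with h | h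
  · rw [Finset.filter_true_of_mem fun j _ => h ▸ (hσ.1 j).2]
    simp [h]
  · calc σ i = (Finset.Icc 1 (σ i)).card := by simp
      _ ≤ ((Finset.univ.filter fun j => σ j ≤ σ i).image σ).card := by
          refine Finset.card_le_card fun t ht => ?_
          rw [Finset.mem_Icc] at ht
          obtain ⟨j, rfl⟩ := hσ.2.2 i t ht.1 ht.2 h
          exact Finset.mem_image_of_mem σ (by simpa using ht.2)
      _ ≤ _ := Finset.card_image_le

theorem eq_sum (hσ : IsBallot m σ) (i : Fin m) :
    (σ i : ℤ) = ∑ j, if σ j ≤ σ i then 1 else 0 := by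
  rw [Finset.sum_boole, hσ.card_eq]

theorem sum_between_le (hτ : IsBallot m τ) (i : Fin m) {s : ℕ} (hs : s ≤ m) (his : τ i ≤ s) :
    ∑ j, (if τ i < τ j ∧ τ j ≤ s then (1 : ℤ) else 0) ≤ s - τ i := by
  have hle : ∑ j, (if τ j ≤ s then (1 : ℤ) else 0) ≤ s := by
    rw [Finset.sum_boole]
    exact_mod_cast hτ.card_le hs
  have hi := hτ.eq_sum i
  have hsum : ∑ j, (if τ i < τ j ∧ τ j ≤ s then (1 : ℤ) else 0)
      + ∑ j, (if τ j ≤ τ i then (1 : ℤ) else 0) = ∑ j, (if τ j ≤ s then (1 : ℤ) else 0) := by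
    rw [← Finset.sum_add_distrib]
    refine Finset.sum_congr rfl fun j _ => ?_
    split_ifs <;> omega
  omega

theorem charge_comm (σ τ : Fin m → ℕ) (i j : Fin m) : charge σ τ i j = charge τ σ i j :=
  add_comm _ _

theorem charge_of_le (h : τ i ≤ σ i) (j : Fin m) :
    charge σ τ i j = if τ i < τ j ∧ τ j ≤ σ i then 1 else 0 := by
  unfold charge
  split_ifs <;> omega

theorem sum_charge_le (hσ : IsBallot m σ) (hτ : IsBallot m τ) (i : Fin m) :
    ∑ j, charge σ τ i j ≤ |(σ i : ℤ) - τ i| := by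
  wlog h : τ i ≤ σ i generalizing σ τ
  · rw [abs_sub_comm]
    simp_rw [charge_comm σ τ]
    exact this hτ hσ (by omega)
  · simp_rw [charge_of_le h]
    rw [abs_of_nonneg (by omega)]
    exact hτ.sum_between_le i (hσ.1 i).2 h

/-- If no candidate has rank `σ i` in `τ`, the charge of `i` is strictly below its displacement. -/
theorem sum_charge_lt (hσ : IsBallot m σ) (hτ : IsBallot m τ) {i : Fin m} (h : τ i < σ i)
    (hne : ∀ j, τ j ≠ σ i) : ∑ j, charge σ τ i j < |(σ i : ℤ) - τ i| := by
  have hsum := hτ.sum_between_le i (s := σ i - 1) (by have := (hσ.1 i).2; omega) (by omega)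
  have heq : ∑ j, charge σ τ i j
      = ∑ j, (if τ i < τ j ∧ τ j ≤ σ i - 1 then (1 : ℤ) else 0) := by
    refine Finset.sum_congr rfl fun j _ => ?_
    have := hne j
    rw [charge_of_le h.le]
    split_ifs <;> omega
  rw [heq, abs_of_nonneg (by omega)]
  omega

theorem dis_le_charge (hσ : IsBallot m σ) (hτ : IsBallot m τ) (i j : Fin m) :
    (if StrongDis σ τ i j then (1 : ℤ) else 0) + (if WeakDis σ τ i j then 1 else 0)
      ≤ charge σ τ i j + charge σ τ j i := by
  have h₁ := hσ.1 i
  have h₂ := hσ.1 j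
  have h₃ := hτ.1 i
  have h₄ := hτ.1 j
  unfold charge StrongDis WeakDis
  by_cases hij : i = j
  · subst hij
    split_ifs <;> omega
  · have h₅ : σ i = σ j → σ i = m := fun h => by
      by_contra
      exact hij (hσ.2.1 i j (by omega) h)
    have h₆ : τ i = τ j → τ i = m := fun h => by
      by_contra
      exact hij (hτ.2.1 i j (by omega) h)
    split_ifs <;> omega

/-- The total charge bound on `str + wk` is strict, at some pair or at some candidate. -/
def Slack {m : ℕ} (σ τ : Fin m → ℕ) : Prop :=
  (∃ i j, i < j ∧
    (if StrongDis σ τ i j then (1 : ℤ) else 0) + (if WeakDis σ τ i j then 1 else 0)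
      < charge σ τ i j + charge σ τ j i) ∨
  ∃ i, ∑ j, charge σ τ i j < |(σ i : ℤ) - τ i|

theorem Slack.of_pair {i j : Fin m} (hij : i ≠ j)
    (h : (if StrongDis σ τ i j then (1 : ℤ) else 0) + (if WeakDis σ τ i j then 1 else 0)
      < charge σ τ i j + charge σ τ j i) : Slack σ τ := by
  rcases hij.lt_or_gt with hlt | hlt
  · exact .inl ⟨i, j, hlt, h⟩
  · refine .inl ⟨j, i, hlt, lt_of_eq_of_lt ?_ (h.trans_eq (add_comm _ _))⟩
    unfold StrongDis WeakDis
    split_ifs <;> omega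

theorem Slack.symm (h : Slack σ τ) : Slack τ σ := by
  rcases h with ⟨i, j, hij, h⟩ | ⟨i, h⟩
  · refine .inl ⟨i, j, hij, ?_⟩
    rw [charge_comm τ σ, charge_comm τ σ]
    refine lt_of_eq_of_lt ?_ h
    unfold StrongDis WeakDis
    split_ifs <;> omega
  · refine .inr ⟨i, ?_⟩
    rw [abs_sub_comm]
    simpa only [charge_comm τ σ] using h

theorem Slack.of_touching {i j : Fin m} (hτ : τ i < τ j) (hσ : σ j < σ i) (h : τ j = σ i) :
    Slack σ τ := by
  refine .of_pair (i := i) (j := j) (by rintro rfl; omega) ?_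
  unfold charge StrongDis WeakDis
  split_ifs <;> omega

theorem slack_of_lt (hσ : IsBallot m σ) (hτ : IsBallot m τ) {i : Fin m} (h : τ i < σ i)
    (hm : σ i < m) : Slack σ τ := by
  by_cases hne : ∀ j, τ j ≠ σ i
  · exact .inr ⟨i, sum_charge_lt hσ hτ h hne⟩
  · push Not at hne
    obtain ⟨j, hj⟩ := hne
    have hij : i ≠ j := by rintro rfl; omega
    rcases lt_trichotomy (σ j) (σ i) with hlt | heq | hgt
    · exact .of_touching (by omega) hlt hj
    · exact absurd (hσ.2.1 i j hm heq.symm) hij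
    · refine .of_pair hij ?_
      unfold charge StrongDis WeakDis
      split_ifs <;> omega

theorem slack_of_strong_of_le (hσ : IsBallot m σ) (hτ : IsBallot m τ) {i j : Fin m}
    (hτij : τ i < τ j) (hσij : σ j < σ i) (h : τ j ≤ σ i) : Slack σ τ := by
  by_contra hs
  have hagree (v : Fin m) (h₁ : σ v < m) (h₂ : τ v < m) : σ v = τ v := by
    by_contra hne
    rcases Nat.lt_or_gt_of_ne hne with hlt | hlt
    · exact hs (slack_of_lt hτ hσ hlt h₂).symm
    · exact hs (slack_of_lt hσ hτ hlt h₁)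
  have hσi := hσ.1 i
  have hσj := hσ.1 j
  have hτi := hτ.1 i
  have hτj := hτ.1 j
  have him : σ i = m := by
    by_contra
    have := hagree i (by omega) (by omega)
    omega
  have hjm : τ j ≠ m := fun hjm => hs (.of_touching hτij hσij (by omega))
  have hj := hagree j (by omega) (by omega)
  obtain ⟨v, hv⟩ := hσ.2.2 j (τ i) (by omega) (by omega) (by omega)
  have hτv := hτ.1 v
  have hvm : τ v = m := by
    by_contra
    have hv' := hagree v (by omega) (by omega)
    have := hτ.2.1 v i (by omega) (by omega)
    subst this
    omega
  exact hs (.of_touching (i := i) (j := v) (by omega) (by omega) (by omega))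

theorem slack_of_strongDis (hσ : IsBallot m σ) (hτ : IsBallot m τ) {i j : Fin m}
    (h : StrongDis σ τ i j) : Slack σ τ := by
  wlog hij : σ j < σ i ∧ τ i < τ j generalizing i j
  · exact this (i := j) (j := i) h.symm (by rcases h with h | h <;> omega)
  rcases le_or_gt (τ j) (σ i) with hle | hlt
  · exact slack_of_strong_of_le hσ hτ hij.2 hij.1 hle
  · exact (slack_of_strong_of_le hτ hσ hij.1 hij.2 hlt.le).symm

theorem sum_sum_charge (σ τ : Fin m → ℕ) :
    ∑ i, ∑ j, charge σ τ i j = ∑ p ∈ Finset.univ.filter (fun p : Fin m × Fin m => p.1 < p.2),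
      (charge σ τ p.1 p.2 + charge σ τ p.2 p.1) :=
  sum_sum_eq_sum_lt _ fun i => by simp [charge]

theorem str_add_wk_le (hσ : IsBallot m σ) (hτ : IsBallot m τ) :
    (strDis σ τ : ℤ) + wkDis σ τ ≤ ∑ i, |(σ i : ℤ) - τ i| := by
  rw [strDis_eq_sum, wkDis_eq_sum, ← Finset.sum_add_distrib]
  refine (Finset.sum_le_sum fun p _ => dis_le_charge hσ hτ p.1 p.2).trans ?_
  rw [← sum_sum_charge]
  exact Finset.sum_le_sum fun i _ => sum_charge_le hσ hτ i

theorem str_add_wk_lt (hσ : IsBallot m σ) (hτ : IsBallot m τ) (hpos : 0 < strDis σ τ) :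
    (strDis σ τ : ℤ) + wkDis σ τ < ∑ i, |(σ i : ℤ) - τ i| := by
  obtain ⟨p, hp⟩ := Finset.card_pos.mp hpos
  have hslack := slack_of_strongDis hσ hτ (Finset.mem_filter.mp hp).2.2
  rw [strDis_eq_sum, wkDis_eq_sum, ← Finset.sum_add_distrib]
  rcases hslack with ⟨i, j, hij, h⟩ | ⟨i, h⟩
  · refine (Finset.sum_lt_sum (fun p _ => dis_le_charge hσ hτ p.1 p.2)
      ⟨(i, j), by simpa using hij, h⟩).trans_le ?_
    rw [← sum_sum_charge]
    exact Finset.sum_le_sum fun i _ => sum_charge_le hσ hτ i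
  · refine (Finset.sum_le_sum fun p _ => dis_le_charge hσ hτ p.1 p.2).trans_lt ?_
    rw [← sum_sum_charge]
    exact Finset.sum_lt_sum (fun i _ => sum_charge_le hσ hτ i) ⟨i, Finset.mem_univ i, h⟩

theorem sum_abs_le (hσ : IsBallot m σ) (hτ : IsBallot m τ) :
    ∑ i, |(σ i : ℤ) - τ i| ≤ 2 * strDis σ τ + wkDis σ τ := by
  calc ∑ i, |(σ i : ℤ) - τ i|
      ≤ ∑ i, ∑ j, |(if σ j ≤ σ i then (1 : ℤ) else 0) - (if τ j ≤ τ i then 1 else 0)| := by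
        refine Finset.sum_le_sum fun i _ => ?_
        rw [hσ.eq_sum i, hτ.eq_sum i, ← Finset.sum_sub_distrib]
        exact Finset.abs_sum_le_sum_abs _ _
    _ = 2 * strDis σ τ + wkDis σ τ := by
        rw [sum_sum_eq_sum_lt _ fun i => by simp, strDis_eq_sum, wkDis_eq_sum, Finset.mul_sum,
          ← Finset.sum_add_distrib]
        refine Finset.sum_congr rfl fun p _ => ?_
        unfold StrongDis WeakDis
        split_ifs <;> first | omega | norm_num

end IsBallot

/-- For all partial ballots `σ, τ` on `m` candidates,
`(1/2)·str + (1/2)·wk ≤ d_B ≤ str + (1/2)·wk = d_H`, and the first inequality is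
strict whenever `str(σ,τ) > 0`. -/
theorem half_str_add_half_wk_le_dB_le_dH (m : ℕ) (σ τ : Ballot m) :
    (1 / 2) * (strDis σ.1 τ.1 : ℝ) + (1 / 2) * (wkDis σ.1 τ.1 : ℝ) ≤ dB m σ.1 τ.1 ∧
    dB m σ.1 τ.1 ≤ (strDis σ.1 τ.1 : ℝ) + (1 / 2) * (wkDis σ.1 τ.1 : ℝ) ∧
    (strDis σ.1 τ.1 : ℝ) + (1 / 2) * (wkDis σ.1 τ.1 : ℝ) = dH σ.1 τ.1 ∧
    (0 < strDis σ.1 τ.1 →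
      (1 / 2) * (strDis σ.1 τ.1 : ℝ) + (1 / 2) * (wkDis σ.1 τ.1 : ℝ) < dB m σ.1 τ.1) := by
  have hlow := σ.2.str_add_wk_le τ.2
  have hup := σ.2.sum_abs_le τ.2
  have hlt := σ.2.str_add_wk_lt τ.2
  rw [← Int.cast_le (R := ℝ)] at hlow hup
  rw [← Int.cast_lt (R := ℝ)] at hlt
  rw [dB_eq_sum]
  refine ⟨?_, ?_, str_add_half_wk_eq_dH _ _, fun hpos => ?_⟩
  · rw [Int.cast_add, Int.cast_natCast, Int.cast_natCast] at hlow
    linarith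
  · rw [Int.cast_add, Int.cast_mul, Int.cast_natCast, Int.cast_natCast, Int.cast_ofNat] at hup
    linarith
  · have := hlt hpos
    rw [Int.cast_add, Int.cast_natCast, Int.cast_natCast] at this
    linarith
end

section
/- For all distinct partial ballots σ ≠ τ on m candidates, d_B(σ,τ) ≤ d_H(σ,τ) < 2·d_B(σ,τ); equivalently, the ratio d_H(σ,τ)/d_B(σ,τ) lies in the interval [1, 2). -/
open Finset

/-- The number of ordered pairs that `σ` ranks strictly and `τ` does not rank in the same way. -/
def reversals {m : ℕ} (σ τ : Fin m → ℕ) : ℕ :=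
  ∑ i, #{j | σ i < σ j ∧ τ j ≤ τ i}

/-- Twice the Borda distance, as a natural number. -/
def footrule {m : ℕ} (σ τ : Fin m → ℕ) : ℕ :=
  ∑ i, ((σ i - τ i) + (τ i - σ i))

theorem footrule_comm {m : ℕ} (σ τ : Fin m → ℕ) : footrule σ τ = footrule τ σ :=
  sum_congr rfl fun _ _ => add_comm _ _

theorem two_mul_dB {m : ℕ} (σ τ : Fin m → ℕ) : 2 * dB m σ τ = footrule σ τ := by
  unfold dB footrule bordaEmb
  rw [← mul_assoc, show (2 : ℝ) * (1 / 2) = 1 by norm_num, one_mul, Nat.cast_sum]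
  refine sum_congr rfl fun i _ => ?_
  rcases le_total (σ i) (τ i) with h | h
  · have h' : (σ i : ℝ) ≤ τ i := by exact_mod_cast h
    rw [abs_of_nonneg (by linarith), Nat.sub_eq_zero_of_le h, zero_add, Nat.cast_sub h]
    ring
  · have h' : (τ i : ℝ) ≤ σ i := by exact_mod_cast h
    rw [abs_of_nonpos (by linarith), Nat.sub_eq_zero_of_le h, add_zero, Nat.cast_sub h]
    ring

theorem sum_eq_sum_lt_add_swap {m : ℕ} (f : Fin m → Fin m → ℝ) (hf : ∀ i, f i i = 0) :
    ∑ i, ∑ j, f i j =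
      ∑ p ∈ univ.filter (fun p : Fin m × Fin m => p.1 < p.2), (f p.1 p.2 + f p.2 p.1) := by
  have hsplit : ∀ i j : Fin m,
      f i j = (if i < j then f i j else 0) + (if j < i then f i j else 0) := by
    intro i j
    rcases lt_trichotomy i j with h | rfl | h
    · simp [h, h.not_gt]
    · simp [hf]
    · simp [h, h.not_gt]
  calc ∑ i, ∑ j, f i j
      = ∑ i, ∑ j, (if i < j then f i j else 0) + ∑ i, ∑ j, (if j < i then f i j else 0) := by
        simp only [← sum_add_distrib, ← hsplit]
    _ = ∑ i, ∑ j, (if i < j then f i j else 0) + ∑ i, ∑ j, (if i < j then f j i else 0) := by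
        congr 1
        exact sum_comm
    _ = _ := by
        rw [sum_filter, Fintype.sum_prod_type, ← sum_add_distrib]
        refine sum_congr rfl fun i _ => ?_
        rw [← sum_add_distrib]
        refine sum_congr rfl fun j _ => ?_
        split_ifs <;> simp

theorem two_mul_dH {m : ℕ} (σ τ : Fin m → ℕ) :
    2 * dH σ τ = reversals σ τ + reversals τ σ := by
  have key := sum_eq_sum_lt_add_swap
    (fun i j : Fin m => (if σ i < σ j ∧ τ j ≤ τ i then (1 : ℝ) else 0) +
      (if τ i < τ j ∧ σ j ≤ σ i then (1 : ℝ) else 0)) (by simp)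
  have hsum : ((reversals σ τ : ℝ) + reversals τ σ) =
      ∑ i, ∑ j, ((if σ i < σ j ∧ τ j ≤ τ i then (1 : ℝ) else 0) +
        (if τ i < τ j ∧ σ j ≤ σ i then (1 : ℝ) else 0)) := by
    simp only [reversals, card_filter, Nat.cast_sum, sum_add_distrib, Nat.cast_ite, Nat.cast_one,
      Nat.cast_zero]
  rw [hsum, key, dH, ← mul_assoc, show (2 : ℝ) * (1 / 2) = 1 by norm_num, one_mul]
  refine sum_congr rfl fun p _ => ?_
  unfold hcoord
  split_ifs <;> first | (exfalso; omega) | norm_num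

namespace IsBallot

variable {m : ℕ} {σ τ : Fin m → ℕ}

theorem card_rank_mem_le (hσ : IsBallot m σ) {s : Finset ℕ} (hs : ∀ r ∈ s, r < m) :
    #{j | σ j ∈ s} ≤ #s := by
  refine card_le_card_of_injOn σ (fun j hj => by simpa using hj) fun j hj j' _ h => ?_
  exact hσ.2.1 j j' (hs _ (by simpa using hj)) h

/-- The Borda score of a candidate is the number of candidates it strictly beats. -/
theorem card_lt_add_rank (hσ : IsBallot m σ) (i : Fin m) : #{j | σ i < σ j} + σ i = m := by
  rcases (hσ.1 i).2.lt_or_eq with hi | hi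
  · have hle : #{j | ¬ σ i < σ j} = σ i := by
      have himage : ({j | ¬ σ i < σ j} : Finset (Fin m)).image σ = Icc 1 (σ i) := by
        ext r
        simp only [mem_image, mem_filter, mem_univ, true_and, not_lt, mem_Icc]
        constructor
        · rintro ⟨j, hj, rfl⟩
          exact ⟨(hσ.1 j).1, hj⟩
        · rintro ⟨h1, h2⟩
          obtain ⟨j, rfl⟩ := hσ.2.2 i r h1 h2 hi
          exact ⟨j, h2, rfl⟩
      rw [← card_image_of_injOn (f := σ), himage, Nat.card_Icc, Nat.add_sub_cancel]
      intro j hj j' _ h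
      have hj' : σ j ≤ σ i := by simpa using hj
      exact hσ.2.1 j j' (hj'.trans_lt hi) h
    have := card_filter_add_card_filter_not (s := (univ : Finset (Fin m))) (fun j => σ i < σ j)
    rw [hle, card_univ, Fintype.card_fin] at this
    exact this
  · rw [filter_false_of_mem fun j _ => by have := (hσ.1 j).2; omega, card_empty, hi, zero_add]

theorem rank_sub_le (hσ : IsBallot m σ) (hτ : IsBallot m τ) (i : Fin m) :
    σ i - τ i ≤ #{j | τ i < τ j ∧ σ j ≤ σ i} := by
  have h : #{j | τ i < τ j} ≤ #{j | τ i < τ j ∧ σ j ≤ σ i} + #{j | σ i < σ j} := by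
    refine (card_le_card fun j hj => ?_).trans (card_union_le _ _)
    simp only [mem_filter, mem_univ, true_and, mem_union] at hj ⊢
    omega
  have h1 := hσ.card_lt_add_rank i
  have h2 := hτ.card_lt_add_rank i
  omega

theorem footrule_le_reversals (hσ : IsBallot m σ) (hτ : IsBallot m τ) :
    footrule σ τ ≤ reversals σ τ + reversals τ σ := by
  unfold footrule reversals
  rw [← sum_add_distrib]
  refine sum_le_sum fun i _ => ?_
  rw [add_comm (#_)]
  exact add_le_add (hσ.rank_sub_le hτ i) (hτ.rank_sub_le hσ i)

theorem card_rank_mem_Ioc_le (hσ : IsBallot m σ) (i : Fin m) {r : ℕ} (hr : r ≤ m) :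
    #{j | σ i < σ j ∧ σ j ≤ r} ≤ r - σ i := by
  rcases hr.lt_or_eq with hr | rfl
  · have := hσ.card_rank_mem_le (s := Ioc (σ i) r) fun s hs => (mem_Ioc.1 hs).2.trans_lt hr
    simpa using this
  · have h := hσ.card_lt_add_rank i
    have : #{j | σ i < σ j ∧ σ j ≤ r} ≤ #{j | σ i < σ j} :=
      card_le_card <| monotone_filter_right _ fun _ _ h => h.1
    omega

theorem card_rank_mem_Ico_add_le (hτ : IsBallot m τ) (j : Fin m) {r : ℕ} (hr : r ≤ m) :
    #{i | i ≠ j ∧ τ j ≤ τ i ∧ τ i < r} + (if τ j < r then 1 else 0) ≤ r - τ j := by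
  have h := hτ.card_rank_mem_le (s := Ico (τ j) r) fun s hs => (mem_Ico.1 hs).2.trans_le hr
  rw [Nat.card_Ico] at h
  refine le_trans ?_ h
  split_ifs with hj
  · rw [← card_insert_of_notMem (a := j) (by simp)]
    refine card_le_card fun i hi => ?_
    simp only [mem_insert, mem_filter, mem_univ, true_and, mem_Ico] at hi ⊢
    rcases hi with rfl | hi
    · exact ⟨le_rfl, hj⟩
    · exact hi.2
  · rw [add_zero]
    refine card_le_card fun i hi => ?_
    simp only [mem_filter, mem_univ, true_and, mem_Ico] at hi ⊢
    exact hi.2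

/-- A reversed pair `(i, j)` is charged to `i` if `σ j ≤ τ i`, and to `j` otherwise. -/
theorem reversals_add_card_le (hσ : IsBallot m σ) (hτ : IsBallot m τ) :
    reversals σ τ + #{j | τ j < σ j} ≤ footrule σ τ := by
  have hcharge : reversals σ τ ≤ ∑ i, #{j | σ i < σ j ∧ σ j ≤ τ i} +
      ∑ j, #{i | i ≠ j ∧ τ j ≤ τ i ∧ τ i < σ j} := by
    unfold reversals
    simp only [card_filter]
    rw [sum_comm (s := univ) (t := univ)
      (f := fun j i => if i ≠ j ∧ τ j ≤ τ i ∧ τ i < σ j then 1 else 0), ← sum_add_distrib]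
    refine sum_le_sum fun i _ => ?_
    rw [← sum_add_distrib]
    refine sum_le_sum fun j _ => ?_
    rcases eq_or_ne i j with rfl | hij
    · simp
    · split_ifs <;> omega
  have hright := sum_le_sum fun i (_ : i ∈ univ) => hσ.card_rank_mem_Ioc_le i (hτ.1 i).2
  have hleft := sum_le_sum fun j (_ : j ∈ univ) => hτ.card_rank_mem_Ico_add_le j (hσ.1 j).2
  rw [sum_add_distrib, ← card_filter] at hleft
  unfold footrule
  rw [sum_add_distrib]
  omega

theorem reversals_lt_two_mul_footrule (hσ : IsBallot m σ) (hτ : IsBallot m τ) (hne : σ ≠ τ) :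
    reversals σ τ + reversals τ σ < 2 * footrule σ τ := by
  obtain ⟨i, hi⟩ := Function.ne_iff.1 hne
  have h1 := hσ.reversals_add_card_le hτ
  have h2 := hτ.reversals_add_card_le hσ
  rw [footrule_comm] at h2
  rcases hi.lt_or_gt with h | h
  · have : 0 < #{j | σ j < τ j} := card_pos.2 ⟨i, by simpa using h⟩
    omega
  · have : 0 < #{j | τ j < σ j} := card_pos.2 ⟨i, by simpa using h⟩
    omega

end IsBallot

/-- For all distinct partial ballots `σ ≠ τ` on `m` candidates,
`d_B(σ,τ) ≤ d_H(σ,τ) < 2·d_B(σ,τ)`; equivalently, `d_H(σ,τ)/d_B(σ,τ) ∈ [1, 2)`. -/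
theorem dB_le_dH_lt_two_dB (m : ℕ) (σ τ : Ballot m) (hne : σ ≠ τ) :
    (dB m σ.1 τ.1 ≤ dH σ.1 τ.1 ∧ dH σ.1 τ.1 < 2 * dB m σ.1 τ.1) ∧
    (1 ≤ dH σ.1 τ.1 / dB m σ.1 τ.1 ∧ dH σ.1 τ.1 / dB m σ.1 τ.1 < 2) := by
  have hB := two_mul_dB σ.1 τ.1
  have hH := two_mul_dH σ.1 τ.1
  have hle : (footrule σ.1 τ.1 : ℝ) ≤ reversals σ.1 τ.1 + reversals τ.1 σ.1 := by
    exact_mod_cast σ.2.footrule_le_reversals τ.2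
  have hlt : (reversals σ.1 τ.1 + reversals τ.1 σ.1 : ℝ) < 2 * footrule σ.1 τ.1 := by
    exact_mod_cast σ.2.reversals_lt_two_mul_footrule τ.2 fun h => hne (Subtype.ext h)
  have hpos : 0 < dB m σ.1 τ.1 := by linarith
  rw [one_le_div hpos, div_lt_iff₀ hpos]
  refine ⟨⟨?_, ?_⟩, ?_, ?_⟩ <;> linarith
end

section
/- The bounds 1 ≤ d_H/d_B < 2 are sharp: (i) any two complete ballots differing by a single swap of candidates in consecutive positions satisfy d_H = d_B = 1; and (ii) for each m ≥ 2, if σ_m = (A_1, …, A_m) is a complete ballot and σ̂_m = (A_m, …, A_1) is its reversal, then d_H(σ_m, σ̂_m) = m(m−1)/2 and d_B(σ_m, σ̂_m) = ⌊m²/2⌋/2, so that d_H(σ_m, σ̂_m)/d_B(σ_m, σ̂_m) → 2 as m → ∞. -/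
/-- The complete ballot `(A_1, …, A_m)`: candidate `i` is ranked in position `i+1`
(zero-based index). -/
def idBallot (m : ℕ) : Ballot m :=
  ⟨fun i => i.1 + 1, by
    refine ⟨?_, ?_, ?_⟩
    · intro i
      have hi := i.2
      refine ⟨?_, ?_⟩
      · show 1 ≤ i.1 + 1
        omega
      · show i.1 + 1 ≤ m
        omega
    · intro i i' _ h
      have h' : i.1 + 1 = i'.1 + 1 := h
      exact Fin.ext (by omega)
    · intro i j h1 h2 h3
      have h2' : j ≤ i.1 + 1 := h2
      have h3' : i.1 + 1 < m := h3
      refine ⟨⟨j - 1, by omega⟩, ?_⟩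
      show j - 1 + 1 = j
      omega⟩

/-- The reversal `(A_m, …, A_1)` of the ballot `(A_1, …, A_m)`. -/
def revBallot (m : ℕ) : Ballot m :=
  ⟨fun i => m - i.1, by
    refine ⟨?_, ?_, ?_⟩
    · intro i
      have hi := i.2
      refine ⟨?_, ?_⟩
      · show 1 ≤ m - i.1
        omega
      · show m - i.1 ≤ m
        omega
    · intro i i' h h'
      have hi := i.2
      have hi' := i'.2
      have h1 : m - i.1 < m := h
      have h2 : m - i.1 = m - i'.1 := h'
      exact Fin.ext (by omega)
    · intro i j h1 h2 h3
      have hi := i.2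
      have h2' : j ≤ m - i.1 := h2
      have h3' : m - i.1 < m := h3
      refine ⟨⟨m - j, by omega⟩, ?_⟩
      show m - (m - j) = j
      omega⟩

/-- The number of pairs `i < j` in `Fin m` is `m (m - 1) / 2`. -/
theorem card_filter_fst_lt_snd (m : ℕ) :
    (Finset.univ.filter (fun p : Fin m × Fin m => p.1 < p.2)).card = m * (m - 1) / 2 := by
  have h : (Finset.univ.filter (fun p : Fin m × Fin m => p.1 < p.2)).card
      = ∑ i : Fin m, (m - 1 - i.1) := by
    rw [Finset.card_filter, Fintype.sum_prod_type]
    refine Finset.sum_congr rfl fun i _ => ?_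
    rw [← Finset.card_filter, ← Fin.card_Ioi]
    congr 1
    ext j
    simp
  rw [h, ← Finset.sum_range (fun i => m - 1 - i), Finset.sum_range_reflect (fun i => i) m,
    Finset.sum_range_id]

theorem sum_range_abs_sub_two_mul (m : ℕ) :
    ∑ i ∈ Finset.range m, |(m : ℝ) - 1 - 2 * (i : ℝ)| = ((m ^ 2 / 2 : ℕ) : ℝ) := by
  induction m using Nat.twoStepInduction with
  | zero => simp
  | one => simp
  | more m ih _ =>
    have hsq : (m + 2) ^ 2 / 2 = m ^ 2 / 2 + 2 * (m + 1) := by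
      rw [show (m + 2) ^ 2 = m ^ 2 + 2 * (m + 1) * 2 by ring]
      omega
    have hmid : ∀ i ∈ Finset.range m,
        |((m + 2 : ℕ) : ℝ) - 1 - 2 * ((i + 1 : ℕ) : ℝ)| = |(m : ℝ) - 1 - 2 * (i : ℝ)| := by
      intro i _
      congr 1
      push_cast
      ring
    have hm : (0 : ℝ) ≤ m := m.cast_nonneg
    have hfirst : |((m + 2 : ℕ) : ℝ) - 1 - 2 * ((0 : ℕ) : ℝ)| = m + 1 := by
      rw [abs_of_nonneg] <;> push_cast <;> linarith
    have hlast : |((m + 2 : ℕ) : ℝ) - 1 - 2 * ((m + 1 : ℕ) : ℝ)| = m + 1 := by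
      rw [abs_of_nonpos] <;> push_cast <;> linarith
    rw [Finset.sum_range_succ, Finset.sum_range_succ', Finset.sum_congr rfl hmid, ih, hfirst,
      hlast, hsq]
    push_cast
    ring

theorem dH_id_rev (m : ℕ) :
    dH (idBallot m).1 (revBallot m).1 = ((m * (m - 1) / 2 : ℕ) : ℝ) := by
  have h : ∀ p ∈ Finset.univ.filter (fun p : Fin m × Fin m => p.1 < p.2),
      |hcoord (idBallot m).1 p.1 p.2 - hcoord (revBallot m).1 p.1 p.2| = 2 := by
    rintro ⟨i, j⟩ hp
    have hij : i.1 < j.1 := by simpa using hp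
    have hj := j.2
    have hid : hcoord (idBallot m).1 i j = -1 := by
      change (if j.1 + 1 < i.1 + 1 then (1 : ℝ) else if i.1 + 1 = j.1 + 1 then 0 else -1) = -1
      rw [if_neg (by omega), if_neg (by omega)]
    have hrev : hcoord (revBallot m).1 i j = 1 := by
      exact if_pos (show m - j.1 < m - i.1 by omega)
    rw [hid, hrev]
    norm_num
  rw [dH, Finset.sum_congr rfl h, Finset.sum_const, card_filter_fst_lt_snd, nsmul_eq_mul]
  ring

theorem dB_id_rev (m : ℕ) :
    dB m (idBallot m).1 (revBallot m).1 = ((m ^ 2 / 2 : ℕ) : ℝ) / 2 := by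
  have h : ∀ i : Fin m, |bordaEmb m (idBallot m).1 i - bordaEmb m (revBallot m).1 i|
      = |(m : ℝ) - 1 - 2 * (i.1 : ℝ)| := by
    intro i
    congr 1
    simp only [bordaEmb, idBallot, revBallot]
    rw [Nat.cast_sub i.2.le]
    push_cast
    ring
  rw [dB, Finset.sum_congr rfl fun i _ => h i,
    ← Finset.sum_range (fun i : ℕ => |(m : ℝ) - 1 - 2 * (i : ℝ)|), sum_range_abs_sub_two_mul]
  ring

section AdjacentSwap

variable {m : ℕ} {σ τ : Fin m → ℕ} {a b : Fin m}

theorem dB_adjacent_swap (hab : a ≠ b) (hσ : σ b = σ a + 1) (ha : τ a = σ b) (hb : τ b = σ a)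
    (hc : ∀ c, c ≠ a → c ≠ b → τ c = σ c) : dB m σ τ = 1 := by
  rw [dB, Fintype.sum_eq_add a b hab]
  · simp only [bordaEmb, ha, hb, hσ]
    push_cast
    ring_nf
    norm_num
  · rintro c ⟨hca, hcb⟩
    simp [bordaEmb, hc c hca hcb]

theorem dH_adjacent_swap (hinj : Function.Injective σ) (hab : a ≠ b) (hσ : σ b = σ a + 1)
    (ha : τ a = σ b) (hb : τ b = σ a) (hc : ∀ c, c ≠ a → c ≠ b → τ c = σ c) :
    dH σ τ = 1 := by
  have hpair : |hcoord σ a b - hcoord τ a b| = 2 := by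
    unfold hcoord
    rw [if_neg (by omega), if_neg (by omega), if_pos (by omega)]
    norm_num
  have hother : ∀ i j, i ≠ j → ¬ (i = a ∧ j = b) → ¬ (i = b ∧ j = a) →
      hcoord σ i j = hcoord τ i j := by
    intro i j hij h1 h2
    have key : ∀ c, c ≠ a → c ≠ b → τ c = σ c ∧ σ c ≠ σ a ∧ σ c ≠ σ b := fun c hca hcb =>
      ⟨hc c hca hcb, hinj.ne hca, hinj.ne hcb⟩
    have hne := hinj.ne hij
    have hi := key i
    have hj := key j
    have hlt : (σ j < σ i ↔ τ j < τ i) ∧ (σ i = σ j ↔ τ i = τ j) := by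
      by_cases hia : i = a <;> by_cases hib : i = b <;> by_cases hja : j = a <;>
        by_cases hjb : j = b <;> grind
    simp only [hcoord, hlt.1, hlt.2]
  have hsum : ∑ p ∈ Finset.univ.filter (fun p : Fin m × Fin m => p.1 < p.2),
      |hcoord σ p.1 p.2 - hcoord τ p.1 p.2| = 2 := by
    rcases lt_or_gt_of_ne hab with h | h
    · rw [Finset.sum_eq_single_of_mem (a, b) (by simpa using h), hpair]
      rintro ⟨i, j⟩ hp hne
      have hij : i < j := by simpa using hp
      rw [hother i j hij.ne (by simpa using hne) (by rintro ⟨rfl, rfl⟩; exact hij.asymm h),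
        sub_self, abs_zero]
    · rw [Finset.sum_eq_single_of_mem (b, a) (by simpa using h)]
      · rw [← hpair, hcoord_swap σ a b, hcoord_swap τ a b, ← neg_sub', abs_neg]
      rintro ⟨i, j⟩ hp hne
      have hij : i < j := by simpa using hp
      rw [hother i j hij.ne (by rintro ⟨rfl, rfl⟩; exact hij.asymm h) (by simpa using hne),
        sub_self, abs_zero]
  rw [dH, hsum]
  norm_num

end AdjacentSwap

theorem tendsto_dH_div_dB_id_rev :
    Filter.Tendsto
      (fun m : ℕ => dH (idBallot m).1 (revBallot m).1 / dB m (idBallot m).1 (revBallot m).1)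
      Filter.atTop (nhds 2) := by
  have hlim : Filter.Tendsto (fun m : ℕ => (2 : ℝ) - 2 / (m : ℝ)) Filter.atTop (nhds 2) := by
    simpa using tendsto_const_nhds.sub (tendsto_const_div_atTop_nhds_zero_nat (2 : ℝ))
  have hbounds : ∀ m : ℕ, 2 ≤ m →
      2 - 2 / (m : ℝ) ≤ dH (idBallot m).1 (revBallot m).1 / dB m (idBallot m).1 (revBallot m).1 ∧
      dH (idBallot m).1 (revBallot m).1 / dB m (idBallot m).1 (revBallot m).1 ≤ 2 := by
    intro m hm
    rw [dH_id_rev, dB_id_rev]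
    have hle : m * (m - 1) / 2 ≤ m ^ 2 / 2 :=
      Nat.div_le_div_right (by rw [sq]; exact Nat.mul_le_mul_left m (Nat.sub_le m 1))
    have hF : m ^ 2 / 2 * 2 ≤ m ^ 2 := Nat.div_mul_le_self _ _
    have hC : m * (m - 1) / 2 * 2 = m * (m - 1) :=
      Nat.div_mul_cancel (Nat.even_mul_pred_self m).two_dvd
    have hpos : 0 < m ^ 2 / 2 := Nat.div_pos (by nlinarith) two_pos
    generalize m * (m - 1) / 2 = C at *
    generalize m ^ 2 / 2 = F at *
    have hle' : (C : ℝ) ≤ F := by exact_mod_cast hle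
    have hF' : (F : ℝ) * 2 ≤ (m : ℝ) ^ 2 := by exact_mod_cast hF
    have hC' : (C : ℝ) * 2 = m * ((m : ℝ) - 1) := by
      rw [← Nat.cast_pred (by omega)]
      exact_mod_cast hC
    have hpos' : (0 : ℝ) < F := by exact_mod_cast hpos
    have hm' : (2 : ℝ) ≤ m := by exact_mod_cast hm
    have hm0 : (0 : ℝ) < m := by linarith
    constructor
    · rw [le_div_iff₀ (by positivity),
        show (2 - 2 / (m : ℝ)) * (F / 2) = (F * (m - 1)) / m by field_simp,
        div_le_iff₀ hm0]
      nlinarith [mul_le_mul_of_nonneg_right hF' (by linarith : (0 : ℝ) ≤ (m : ℝ) - 1)]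
    · rw [div_le_iff₀ (by positivity)]
      linarith
  refine tendsto_of_tendsto_of_tendsto_of_le_of_le' hlim tendsto_const_nhds ?_ ?_
  · filter_upwards [Filter.eventually_ge_atTop 2] with m hm using (hbounds m hm).1
  · filter_upwards [Filter.eventually_ge_atTop 2] with m hm using (hbounds m hm).2

/-- The bounds `1 ≤ d_H/d_B < 2` are sharp: (i) two complete ballots
differing by a single swap of candidates in consecutive positions satisfy
`d_H = d_B = 1`; (ii) for `m ≥ 2`, the ballot `σ_m = (A_1, …, A_m)` and its reversal
`σ̂_m = (A_m, …, A_1)` satisfy `d_H = m(m-1)/2` and `d_B = ⌊m²/2⌋/2`, so that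
`d_H/d_B → 2` as `m → ∞`. -/
theorem dH_dB_bounds_sharp :
    (∀ (m : ℕ) (σ τ : Ballot m), Function.Injective σ.1 →
      (∃ a b : Fin m, a ≠ b ∧ σ.1 b = σ.1 a + 1 ∧ τ.1 a = σ.1 b ∧ τ.1 b = σ.1 a ∧
        ∀ c, c ≠ a → c ≠ b → τ.1 c = σ.1 c) →
      dH σ.1 τ.1 = 1 ∧ dB m σ.1 τ.1 = 1) ∧
    (∀ m : ℕ, 2 ≤ m →
      dH (idBallot m).1 (revBallot m).1 = ((m * (m - 1) / 2 : ℕ) : ℝ) ∧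
      dB m (idBallot m).1 (revBallot m).1 = ((m ^ 2 / 2 : ℕ) : ℝ) / 2) ∧
    Filter.Tendsto
      (fun m : ℕ => dH (idBallot m).1 (revBallot m).1 / dB m (idBallot m).1 (revBallot m).1)
      Filter.atTop (nhds 2) := by
  refine ⟨?_, fun m _ => ⟨dH_id_rev m, dB_id_rev m⟩, tendsto_dH_div_dB_id_rev⟩
  rintro m σ τ hinj ⟨a, b, hab, hσ, ha, hb, hc⟩
  exact ⟨dH_adjacent_swap hinj hab hσ ha hb hc, dB_adjacent_swap hab hσ ha hb hc⟩
end

section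
/- For all generalized ballots α, β on m candidates, the path-metric distance between α and β in the generalized ballot graph 𝒢̃_m equals d_H(α,β), which in turn equals str(α,β) + (1/2)·wk(α,β). -/
/-- `α` is a generalized ballot on `m` candidates, encoded by the function assigning
to each candidate the position of its block: the blocks are the nonempty preimages,
and positions `1, …, t` are all occupied. -/
def IsGenBallot (m : ℕ) (α : Fin m → ℕ) : Prop :=
  (∀ i, 1 ≤ α i) ∧ ∀ i j, 1 ≤ j → j ≤ α i → ∃ i', α i' = j

/-- A generalized ballot: an ordered partition of the `m` candidates into nonempty
blocks, encoded by its block-position function. -/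
def GenBallot (m : ℕ) : Type := {α : Fin m → ℕ // IsGenBallot m α}

/-- `β` is obtained from `α` by merging the blocks in adjacent positions `p` and
`p + 1`; the corresponding edge of the generalized ballot graph has weight `r·s/2`,
where `r` and `s` are the sizes of the two merged blocks. -/
def MergeAdjW (m : ℕ) (α β : GenBallot m) (w : ℝ) : Prop :=
  ∃ p : ℕ, 1 ≤ p ∧ (∃ i, α.1 i = p + 1) ∧
    (∀ i, β.1 i = if α.1 i ≤ p then α.1 i else α.1 i - 1) ∧
    w = (((Finset.univ.filter (fun i => α.1 i = p)).card : ℝ) *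
          ((Finset.univ.filter (fun i => α.1 i = p + 1)).card : ℝ)) / 2

/-- Weighted adjacency in the generalized ballot graph `𝒢̃_m`. -/
def GenAdjW (m : ℕ) (α β : GenBallot m) (w : ℝ) : Prop :=
  MergeAdjW m α β w ∨ MergeAdjW m β α w

/-- `GenReach m α β c` holds when there is a finite edge-path from `α` to `β` in the
generalized ballot graph `𝒢̃_m` whose edge weights sum to `c`. -/
inductive GenReach (m : ℕ) : GenBallot m → GenBallot m → ℝ → Prop
  | refl (α : GenBallot m) : GenReach m α α 0
  | step {α β γ : GenBallot m} {w c : ℝ} :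
      GenAdjW m α β w → GenReach m β γ c → GenReach m α γ (w + c)

/-- The path metric of the generalized ballot graph `𝒢̃_m`. -/
noncomputable def genGraphDist (m : ℕ) (α β : GenBallot m) : ℝ :=
  sInf {c : ℝ | GenReach m α β c}

theorem abs_hcoord_sub_eq {m : ℕ} (σ τ : Fin m → ℕ) (i j : Fin m) :
    |hcoord σ i j - hcoord τ i j| =
      2 * (if (σ i < σ j ∧ τ j < τ i) ∨ (σ j < σ i ∧ τ i < τ j) then (1 : ℝ) else 0) +
        (if (σ i = σ j ∧ τ i ≠ τ j) ∨ (σ i ≠ σ j ∧ τ i = τ j) then (1 : ℝ) else 0) := by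
  unfold hcoord
  rcases lt_trichotomy (σ i) (σ j) with h | h | h <;>
    rcases lt_trichotomy (τ i) (τ j) with h' | h' | h' <;>
    split_ifs <;> first | omega | norm_num

theorem dH_eq_strDis_add_wkDis {m : ℕ} (σ τ : Fin m → ℕ) :
    dH σ τ = (strDis σ τ : ℝ) + (1 / 2) * (wkDis σ τ : ℝ) := by
  unfold dH strDis wkDis
  simp only [abs_hcoord_sub_eq, Finset.sum_add_distrib, ← Finset.mul_sum, Finset.sum_boole,
    Finset.filter_filter]
  ring

/-- The head-to-head distance as a sum over all ordered pairs. -/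
theorem dH_eq_sum_univ {m : ℕ} (σ τ : Fin m → ℕ) :
    dH σ τ = (1 / 4) * ∑ p : Fin m × Fin m, |hcoord σ p.1 p.2 - hcoord τ p.1 p.2| := by
  have h_split : ∀ p : Fin m × Fin m, |hcoord σ p.1 p.2 - hcoord τ p.1 p.2| =
      (if p.1 < p.2 then |hcoord σ p.1 p.2 - hcoord τ p.1 p.2| else 0) +
      (if p.2 < p.1 then |hcoord σ p.2 p.1 - hcoord τ p.2 p.1| else 0) := by
    rintro ⟨i, j⟩
    rcases lt_trichotomy i j with h | h | h
    · simp [h, h.not_gt]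
    · simp [h, hcoord]
    · simp only [h, h.not_gt, if_true, if_false, zero_add]
      rw [hcoord_swap σ j i, hcoord_swap τ j i, ← abs_neg]
      congr 1
      ring
  have h_swap : (∑ p : Fin m × Fin m,
      if p.2 < p.1 then |hcoord σ p.2 p.1 - hcoord τ p.2 p.1| else 0) =
      ∑ p : Fin m × Fin m, if p.1 < p.2 then |hcoord σ p.1 p.2 - hcoord τ p.1 p.2| else 0 :=
    Equiv.sum_comp (Equiv.prodComm (Fin m) (Fin m))
      (fun p => if p.1 < p.2 then |hcoord σ p.1 p.2 - hcoord τ p.1 p.2| else 0)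
  rw [Finset.sum_congr rfl (fun p _ => h_split p), Finset.sum_add_distrib, h_swap, dH,
    Finset.sum_filter]
  ring

/-- The head-to-head distance is additive through a point whose embedding lies coordinatewise
between the two ends. -/
theorem dH_add_dH_of_between {m : ℕ} {σ τ ρ : Fin m → ℕ}
    (h : ∀ i j, |hcoord σ i j - hcoord τ i j| + |hcoord τ i j - hcoord ρ i j| =
      |hcoord σ i j - hcoord ρ i j|) : dH σ τ + dH τ ρ = dH σ ρ := by
  unfold dH
  rw [← mul_add, ← Finset.sum_add_distrib]
  simp only [h]

theorem sum_indicator_mul_indicator {m : ℕ} (σ : Fin m → ℕ) (p q : ℕ) :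
    ∑ x : Fin m × Fin m, (if σ x.1 = p then 1 else 0) * (if σ x.2 = q then (1 : ℝ) else 0) =
      ((Finset.univ.filter (fun i => σ i = p)).card : ℝ) *
        ((Finset.univ.filter (fun i => σ i = q)).card : ℝ) := by
  rw [Fintype.sum_prod_type, ← Finset.sum_boole, ← Finset.sum_boole, Finset.sum_mul_sum]

theorem MergeAdjW.weight_eq_dH {m : ℕ} {α β : GenBallot m} {w : ℝ} (h : MergeAdjW m α β w) :
    w = dH α.1 β.1 := by
  obtain ⟨p, -, -, hβ, rfl⟩ := h
  have h_pair : ∀ x : Fin m × Fin m, |hcoord α.1 x.1 x.2 - hcoord β.1 x.1 x.2| =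
      (if α.1 x.1 = p then 1 else 0) * (if α.1 x.2 = p + 1 then 1 else 0) +
      (if α.1 x.1 = p + 1 then 1 else 0) * (if α.1 x.2 = p then (1 : ℝ) else 0) := by
    rintro ⟨i, j⟩
    simp only [hcoord, hβ]
    split_ifs <;> first | omega | norm_num
  rw [dH_eq_sum_univ, Finset.sum_congr rfl (fun x _ => h_pair x), Finset.sum_add_distrib,
    sum_indicator_mul_indicator, sum_indicator_mul_indicator]
  ring

theorem MergeAdjW.half_le_weight {m : ℕ} {α β : GenBallot m} {w : ℝ}
    (h : MergeAdjW m α β w) : 1 / 2 ≤ w := by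
  obtain ⟨p, hp, ⟨i, hi⟩, -, rfl⟩ := h
  obtain ⟨i', hi'⟩ := α.2.2 i p hp (by omega)
  have h₁ : 1 ≤ (Finset.univ.filter (fun i => α.1 i = p)).card :=
    Finset.card_pos.2 ⟨i', by simp [hi']⟩
  have h₂ : 1 ≤ (Finset.univ.filter (fun i => α.1 i = p + 1)).card :=
    Finset.card_pos.2 ⟨i, by simp [hi]⟩
  have h₃ : (1 : ℝ) ≤ ((Finset.univ.filter (fun i => α.1 i = p)).card : ℝ) *
      ((Finset.univ.filter (fun i => α.1 i = p + 1)).card : ℝ) := by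
    exact_mod_cast Nat.mul_le_mul h₁ h₂
  linarith

theorem GenAdjW.weight_eq_dH {m : ℕ} {α β : GenBallot m} {w : ℝ} (h : GenAdjW m α β w) :
    w = dH α.1 β.1 :=
  h.elim MergeAdjW.weight_eq_dH (fun h => h.weight_eq_dH.trans (dH_comm _ _))

theorem GenAdjW.half_le_weight {m : ℕ} {α β : GenBallot m} {w : ℝ} (h : GenAdjW m α β w) :
    1 / 2 ≤ w :=
  h.elim MergeAdjW.half_le_weight MergeAdjW.half_le_weight

theorem GenReach.dH_le {m : ℕ} {α β : GenBallot m} {c : ℝ} (h : GenReach m α β c) :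
    dH α.1 β.1 ≤ c := by
  induction h with
  | refl α => exact (dH_self _).le
  | step hw _ ih =>
    rw [hw.weight_eq_dH]
    exact (dH_triangle _ _ _).trans (by gcongr)

theorem GenBallot.le_of_strictMono {m : ℕ} (α β : GenBallot m)
    (h : ∀ i j, α.1 i < α.1 j → β.1 i < β.1 j) (i : Fin m) : α.1 i ≤ β.1 i := by
  induction hn : α.1 i using Nat.strong_induction_on generalizing i with
  | _ n ih =>
    rcases Nat.lt_or_ge 1 n with h₁ | h₁
    · obtain ⟨i', hi'⟩ := α.2.2 i (n - 1) (by omega) (by omega)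
      have h₂ := ih (n - 1) (by omega) i' hi'
      have h₃ := h i' i (by omega)
      omega
    · exact h₁.trans (β.2.1 i)

/-- Generalized ballots that order the candidates in the same way are equal. -/
theorem GenBallot.eq_of_order {m : ℕ} (α β : GenBallot m)
    (h_lt : ∀ i j, α.1 i < α.1 j → β.1 i < β.1 j)
    (h_eq : ∀ i j, α.1 i = α.1 j → β.1 i = β.1 j) : α = β := by
  refine Subtype.ext (funext fun i => le_antisymm (α.le_of_strictMono β h_lt i)
    (β.le_of_strictMono α (fun j k hjk => ?_) i))
  by_contra! hle
  rcases hle.lt_or_eq with h | h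
  · have := h_lt _ _ h
    omega
  · have := h_eq _ _ h
    omega

theorem GenBallot.lt_of_adjacent_lt {m : ℕ} (α : GenBallot m) (σ : Fin m → ℕ)
    (h : ∀ i j, α.1 j = α.1 i + 1 → σ i < σ j) (i j : Fin m) (hij : α.1 i < α.1 j) :
    σ i < σ j := by
  induction hn : α.1 j using Nat.strong_induction_on generalizing j with
  | _ n ih =>
    rcases Nat.lt_or_ge (α.1 i + 1) n with h₁ | h₁
    · obtain ⟨k, hk⟩ := α.2.2 j (n - 1) (by omega) (by omega)
      exact (ih (n - 1) (by omega) k (by omega) hk).trans (h k j (by omega))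
    · exact h i j (by omega)

/-- Merging two adjacent blocks on which `β` has no concordant pair is a step towards `β`. -/
theorem GenBallot.exists_merge_between {m : ℕ} (α : GenBallot m) (σ : Fin m → ℕ) (p : ℕ)
    (hp : 1 ≤ p) (hocc : ∃ i, α.1 i = p + 1)
    (h : ∀ i j, α.1 i = p → α.1 j = p + 1 → σ j ≤ σ i) :
    ∃ (γ : GenBallot m) (w : ℝ), GenAdjW m α γ w ∧ dH α.1 γ.1 + dH γ.1 σ = dH α.1 σ := by
  refine ⟨⟨fun i => if α.1 i ≤ p then α.1 i else α.1 i - 1, ?_, ?_⟩, _,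
    Or.inl ⟨p, hp, hocc, fun i => rfl, rfl⟩, dH_add_dH_of_between fun i j => ?_⟩
  · intro i
    have := α.2.1 i
    dsimp only
    split_ifs <;> omega
  · intro i j hj hji
    dsimp only at hji ⊢
    rcases Nat.lt_or_ge p j with hpj | hpj
    · obtain ⟨k, hk⟩ := α.2.2 i (j + 1) (by omega) (by split_ifs at hji <;> omega)
      exact ⟨k, by rw [if_neg (by omega)]; omega⟩
    · obtain ⟨k, hk⟩ := α.2.2 i j hj (by split_ifs at hji <;> omega)
      exact ⟨k, by rw [if_pos (by omega)]; omega⟩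
  · have h₁ := h i j
    have h₂ := h j i
    simp only [hcoord]
    split_ifs <;> first | omega | norm_num

/-- Splitting a block of `α` on which `β` is not constant is a step towards `β`. -/
theorem GenBallot.exists_split_between {m : ℕ} (α : GenBallot m) (σ : Fin m → ℕ) (u v : Fin m)
    (huv : α.1 u = α.1 v) (hlt : σ u < σ v) :
    ∃ (γ : GenBallot m) (w : ℝ), GenAdjW m α γ w ∧ dH α.1 γ.1 + dH γ.1 σ = dH α.1 σ := by
  have hu := α.2.1 u
  refine ⟨⟨fun i => if α.1 i < α.1 u ∨ (α.1 i = α.1 u ∧ σ i ≤ σ u) then α.1 i else α.1 i + 1,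
    ?_, ?_⟩, _, Or.inr ⟨α.1 u, hu, ⟨v, ?_⟩, fun i => ?_, rfl⟩,
    dH_add_dH_of_between fun i j => ?_⟩
  · intro i
    have := α.2.1 i
    dsimp only
    split_ifs <;> omega
  · intro i j hj hji
    dsimp only at hji ⊢
    rcases lt_trichotomy j (α.1 u) with hju | hju | hju
    · obtain ⟨k, hk⟩ := α.2.2 u j hj hju.le
      exact ⟨k, by rw [if_pos (by omega)]; omega⟩
    · exact ⟨u, by rw [if_pos (by omega)]; omega⟩
    · rcases Nat.lt_or_ge (α.1 u + 1) j with hju' | hju'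
      · obtain ⟨k, hk⟩ := α.2.2 i (j - 1) (by omega) (by split_ifs at hji <;> omega)
        exact ⟨k, by rw [if_neg (by omega)]; omega⟩
      · exact ⟨v, by rw [if_neg (by omega)]; omega⟩
  · dsimp only
    rw [if_neg (by omega)]
    omega
  · dsimp only
    split_ifs <;> omega
  · simp only [hcoord]
    split_ifs <;> first | omega | norm_num

theorem GenBallot.exists_adj_between {m : ℕ} {α β : GenBallot m} (hne : α ≠ β) :
    ∃ (γ : GenBallot m) (w : ℝ),
      GenAdjW m α γ w ∧ dH α.1 γ.1 + dH γ.1 β.1 = dH α.1 β.1 := by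
  by_cases h_const : ∀ i j, α.1 i = α.1 j → β.1 i = β.1 j
  · by_cases h_adj : ∀ i j, α.1 j = α.1 i + 1 → β.1 i < β.1 j
    · exact absurd (α.eq_of_order β (α.lt_of_adjacent_lt β.1 h_adj) h_const) hne
    · push Not at h_adj
      obtain ⟨i, j, hij, hle⟩ := h_adj
      refine α.exists_merge_between β.1 (α.1 i) (α.2.1 i) ⟨j, hij⟩ fun i' j' hi' hj' => ?_
      rw [h_const i' i hi', h_const j' j (hj'.trans hij.symm)]
      exact hle
  · push Not at h_const
    obtain ⟨i, j, hij, hne'⟩ := h_const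
    rcases hne'.lt_or_gt with h | h
    · exact α.exists_split_between β.1 i j hij h
    · exact α.exists_split_between β.1 j i hij.symm h

/-- The head-to-head distance is realized by an edge-path. -/
theorem genReach_dH {m : ℕ} (α β : GenBallot m) : GenReach m α β (dH α.1 β.1) := by
  obtain ⟨n, hn⟩ := exists_nat_ge (2 * dH α.1 β.1)
  induction n generalizing α with
  | zero =>
    by_cases hne : α = β
    · subst hne
      rw [dH_self]
      exact GenReach.refl α
    · obtain ⟨γ, w, hw, hγ⟩ := GenBallot.exists_adj_between hne
      have h₁ := hw.half_le_weight
      rw [hw.weight_eq_dH] at h₁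
      have h₂ := dH_nonneg γ.1 β.1
      push_cast at hn
      linarith
  | succ n ih =>
    by_cases hne : α = β
    · subst hne
      rw [dH_self]
      exact GenReach.refl α
    · obtain ⟨γ, w, hw, hγ⟩ := GenBallot.exists_adj_between hne
      have h₁ := hw.half_le_weight
      rw [← hγ, ← hw.weight_eq_dH]
      rw [← hγ, ← hw.weight_eq_dH] at hn
      push_cast at hn
      exact GenReach.step hw (ih γ (by linarith))

/-- For all generalized ballots `α, β` on `m` candidates, the
path-metric distance between `α` and `β` in the generalized ballot graph `𝒢̃_m`
equals `d_H(α,β)`, which in turn equals `str(α,β) + (1/2)·wk(α,β)`. -/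
theorem genGraphDist_eq_dH (m : ℕ) (α β : GenBallot m) :
    genGraphDist m α β = dH α.1 β.1 ∧
    dH α.1 β.1 = (strDis α.1 β.1 : ℝ) + (1 / 2) * (wkDis α.1 β.1 : ℝ) := by
  refine ⟨?_, dH_eq_strDis_add_wkDis α.1 β.1⟩
  exact IsLeast.csInf_eq ⟨genReach_dH α β, fun c hc => GenReach.dH_le hc⟩
end

section
/- For each integer k ≥ 1, let m = k+3 with candidates A_1, …, A_k, B, X, Y, and consider the generalized ballots α = ({A_1,…,A_k, X}, {B, Y}) and β = ({A_1,…,A_k, Y}, {B, X}). Then d_H(α,β) = k+2 while d_B(α,β) = 2 for every k; consequently d_B(α,β)/d_H(α,β) → 0 as k → ∞, so there is no constant c > 0 with d_B ≥ c·d_H on generalized ballots under the pessimistic Borda convention. -/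
/-- The pessimistic rank of candidate `i` in a generalized ballot: the last position
occupied by its block, i.e. the number of candidates ranked at or above `i`'s block. -/
def genRank {m : ℕ} (α : Fin m → ℕ) (i : Fin m) : ℕ :=
  (Finset.univ.filter (fun j => α j ≤ α i)).card

/-- The Borda distance between generalized ballots under the pessimistic convention:
each candidate receives `m` minus its pessimistic rank as a Borda score. -/
noncomputable def dBgen (m : ℕ) (α β : Fin m → ℕ) : ℝ :=
  dB m (genRank α) (genRank β)

/-- The generalized ballot `({A_1,…,A_k, X}, {B, Y})` on `k+3` candidates, where
`A_t` is candidate `t` for `t < k`, `B` is candidate `k`, `X` is candidate `k+1` and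
`Y` is candidate `k+2`. -/
def alphaGB (k : ℕ) : GenBallot (k + 3) :=
  ⟨fun i => if i.1 = k ∨ i.1 = k + 2 then 2 else 1, by
    refine ⟨fun i => by dsimp only; split <;> omega, ?_⟩
    intro i j h1 h2
    have h2' : j ≤ if i.1 = k ∨ i.1 = k + 2 then 2 else 1 := h2
    have hj : j ≤ 2 := le_trans h2' (by split <;> omega)
    interval_cases j
    · refine ⟨⟨k + 1, by omega⟩, ?_⟩
      show (if k + 1 = k ∨ k + 1 = k + 2 then 2 else 1) = 1
      rw [if_neg (by omega)]
    · refine ⟨⟨k, by omega⟩, ?_⟩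
      show (if k = k ∨ k = k + 2 then 2 else 1) = 2
      rw [if_pos (Or.inl rfl)]⟩

/-- The generalized ballot `({A_1,…,A_k, Y}, {B, X})` on `k+3` candidates. -/
def betaGB (k : ℕ) : GenBallot (k + 3) :=
  ⟨fun i => if i.1 = k ∨ i.1 = k + 1 then 2 else 1, by
    refine ⟨fun i => by dsimp only; split <;> omega, ?_⟩
    intro i j h1 h2
    have h2' : j ≤ if i.1 = k ∨ i.1 = k + 1 then 2 else 1 := h2
    have hj : j ≤ 2 := le_trans h2' (by split <;> omega)
    interval_cases j
    · refine ⟨⟨k + 2, by omega⟩, ?_⟩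
      show (if k + 2 = k ∨ k + 2 = k + 1 then 2 else 1) = 1
      rw [if_neg (by omega)]
    · refine ⟨⟨k, by omega⟩, ?_⟩
      show (if k = k ∨ k = k + 1 then 2 else 1) = 2
      rw [if_pos (Or.inl rfl)]⟩

lemma alphaGB_apply (k : ℕ) (i : Fin (k + 3)) :
    (alphaGB k).1 i = if i.1 = k ∨ i.1 = k + 2 then 2 else 1 := rfl

lemma betaGB_apply (k : ℕ) (i : Fin (k + 3)) :
    (betaGB k).1 i = if i.1 = k ∨ i.1 = k + 1 then 2 else 1 := rfl

/-- The head-to-head discrepancy of `alphaGB k` and `betaGB k` on a pair `i < j`: it is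
supported on the pairs involving `X` or `Y`. -/
lemma abs_hcoord_alphaGB_sub_betaGB (k : ℕ) (i j : Fin (k + 3)) (hij : i < j) :
    |hcoord (alphaGB k).1 i j - hcoord (betaGB k).1 i j| =
      if j.1 = k + 1 then 1 else if j.1 = k + 2 then if i.1 = k + 1 then 2 else 1 else 0 := by
  have hij : i.1 < j.1 := hij
  have hj := j.isLt
  have h₀ : ∀ n < k, n ≠ k := fun n hn => by omega
  have h₁ : ∀ n < k, n ≠ k + 1 := fun n hn => by omega
  have h₂ : ∀ n < k, n ≠ k + 2 := fun n hn => by omega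
  rcases (by omega : j.1 < k ∨ j.1 = k ∨ j.1 = k + 1 ∨ j.1 = k + 2) with h | h | h | h <;>
  rcases (by omega : i.1 < k ∨ i.1 = k ∨ i.1 = k + 1) with h' | h' | h' <;>
  first
  | omega
  | norm_num [hcoord, alphaGB_apply, betaGB_apply, h, h', h₀, h₁, h₂]

lemma dH_alphaGB_betaGB (k : ℕ) : dH (alphaGB k).1 (betaGB k).1 = (k : ℝ) + 2 := by
  have key : ∑ p ∈ Finset.univ.filter (fun p : Fin (k + 3) × Fin (k + 3) => p.1 < p.2),
      |hcoord (alphaGB k).1 p.1 p.2 - hcoord (betaGB k).1 p.1 p.2| = 2 * k + 4 := by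
    rw [Finset.sum_congr rfl fun p hp =>
      abs_hcoord_alphaGB_sub_betaGB k p.1 p.2 (Finset.mem_filter.1 hp).2,
      Finset.sum_filter, Fintype.sum_prod_type_right]
    let g : ℕ → ℕ → ℝ := fun j i => if i < j then
      (if j = k + 1 then 1 else if j = k + 2 then if i = k + 1 then 2 else 1 else 0) else 0
    calc _ = ∑ j : Fin (k + 3), ∑ i : Fin (k + 3), g j i := rfl
      _ = ∑ j ∈ Finset.range (k + 3), ∑ i ∈ Finset.range (k + 3), g j i := by
        rw [← Fin.sum_univ_eq_sum_range (fun j => ∑ i ∈ Finset.range (k + 3), g j i)]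
        exact Finset.sum_congr rfl fun j _ => Fin.sum_univ_eq_sum_range (g j) _
      _ = 2 * k + 4 := by
        have h0 : ∀ j ∈ Finset.range (k + 1), ∑ i ∈ Finset.range (k + 3), g j i = 0 := by
          intro j hj
          have := Finset.mem_range.1 hj
          refine Finset.sum_eq_zero fun i _ => ?_
          simp [g, (show j ≠ k + 1 by omega), (show j ≠ k + 2 by omega)]
        have h1 : ∀ i ∈ Finset.range (k + 1), g (k + 1) i = 1 := by
          intro i hi
          simp [g, Finset.mem_range.1 hi]
        have h2 : ∀ i ∈ Finset.range (k + 1), g (k + 2) i = 1 := by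
          intro i hi
          have := Finset.mem_range.1 hi
          simp [g, (show i < k + 2 by omega), (show i ≠ k + 1 by omega)]
        rw [Finset.sum_range_succ, Finset.sum_range_succ, Finset.sum_eq_zero h0,
          Finset.sum_range_succ (g (k + 1)), Finset.sum_range_succ (g (k + 1)),
          Finset.sum_congr rfl h1, Finset.sum_range_succ (g (k + 2)),
          Finset.sum_range_succ (g (k + 2)), Finset.sum_congr rfl h2]
        simp [g]
        ring
  rw [dH, key]
  ring

lemma genRank_alphaGB (k : ℕ) (i : Fin (k + 3)) :
    genRank (alphaGB k).1 i = if i.1 = k ∨ i.1 = k + 2 then k + 3 else k + 1 := by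
  rw [genRank, Finset.card_filter]
  refine (Fin.sum_univ_eq_sum_range (fun j => if (if j = k ∨ j = k + 2 then 2 else 1) ≤
    (if i.1 = k ∨ i.1 = k + 2 then 2 else 1) then 1 else 0) (k + 3)).trans ?_
  have h : ∀ j ∈ Finset.range k, (if (if j = k ∨ j = k + 2 then 2 else 1) ≤
      (if i.1 = k ∨ i.1 = k + 2 then 2 else 1) then 1 else 0) = 1 := by
    intro j hj
    have := Finset.mem_range.1 hj
    split_ifs <;> omega
  rw [Finset.sum_range_succ, Finset.sum_range_succ, Finset.sum_range_succ,
    Finset.sum_congr rfl h]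
  by_cases hi : i.1 = k ∨ i.1 = k + 2 <;> simp [hi]

lemma genRank_betaGB (k : ℕ) (i : Fin (k + 3)) :
    genRank (betaGB k).1 i = if i.1 = k ∨ i.1 = k + 1 then k + 3 else k + 1 := by
  rw [genRank, Finset.card_filter]
  refine (Fin.sum_univ_eq_sum_range (fun j => if (if j = k ∨ j = k + 1 then 2 else 1) ≤
    (if i.1 = k ∨ i.1 = k + 1 then 2 else 1) then 1 else 0) (k + 3)).trans ?_
  have h : ∀ j ∈ Finset.range k, (if (if j = k ∨ j = k + 1 then 2 else 1) ≤
      (if i.1 = k ∨ i.1 = k + 1 then 2 else 1) then 1 else 0) = 1 := by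
    intro j hj
    have := Finset.mem_range.1 hj
    split_ifs <;> omega
  rw [Finset.sum_range_succ, Finset.sum_range_succ, Finset.sum_range_succ,
    Finset.sum_congr rfl h]
  by_cases hi : i.1 = k ∨ i.1 = k + 1 <;> simp [hi]

lemma dBgen_alphaGB_betaGB (k : ℕ) : dBgen (k + 3) (alphaGB k).1 (betaGB k).1 = 2 := by
  have h : ∀ i : Fin (k + 3), |bordaEmb (k + 3) (genRank (alphaGB k).1) i -
      bordaEmb (k + 3) (genRank (betaGB k).1) i| =
      (fun j : ℕ => if j = k + 1 ∨ j = k + 2 then (2 : ℝ) else 0) i.1 := by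
    intro i
    rw [bordaEmb, bordaEmb, genRank_alphaGB, genRank_betaGB, sub_sub_sub_cancel_left]
    dsimp only
    split_ifs <;> first | omega | (push_cast; ring_nf; norm_num)
  have h0 : ∀ j ∈ Finset.range k, (if j = k + 1 ∨ j = k + 2 then (2 : ℝ) else 0) = 0 := by
    intro j hj
    have := Finset.mem_range.1 hj
    exact if_neg (by omega)
  rw [dBgen, dB, Finset.sum_congr rfl fun i _ => h i,
    Fin.sum_univ_eq_sum_range (fun j => if j = k + 1 ∨ j = k + 2 then (2 : ℝ) else 0),
    Finset.sum_range_succ, Finset.sum_range_succ, Finset.sum_range_succ,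
    Finset.sum_eq_zero h0]
  norm_num

/-- For each `k ≥ 1`, the generalized ballots
`α = ({A_1,…,A_k, X}, {B, Y})` and `β = ({A_1,…,A_k, Y}, {B, X})` on `m = k+3`
candidates satisfy `d_H(α,β) = k+2` and `d_B(α,β) = 2` (pessimistic convention);
consequently `d_B/d_H → 0` as `k → ∞`, and there is no constant `c > 0` with
`d_B ≥ c·d_H` for all generalized ballots. -/
theorem dBgen_dH_ratio_unbounded :
    (∀ k : ℕ, 1 ≤ k →
      dH (alphaGB k).1 (betaGB k).1 = (k : ℝ) + 2 ∧
      dBgen (k + 3) (alphaGB k).1 (betaGB k).1 = 2) ∧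
    Filter.Tendsto
      (fun k : ℕ => dBgen (k + 3) (alphaGB k).1 (betaGB k).1 / dH (alphaGB k).1 (betaGB k).1)
      Filter.atTop (nhds 0) ∧
    ¬ ∃ c : ℝ, 0 < c ∧ ∀ (m : ℕ) (α β : GenBallot m), c * dH α.1 β.1 ≤ dBgen m α.1 β.1 := by
  refine ⟨fun k _ => ⟨dH_alphaGB_betaGB k, dBgen_alphaGB_betaGB k⟩, ?_, ?_⟩
  · simp only [dH_alphaGB_betaGB, dBgen_alphaGB_betaGB]
    exact (Filter.tendsto_atTop_add_const_right _ 2 tendsto_natCast_atTop_atTop).const_div_atTop 2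
  · rintro ⟨c, hc, h⟩
    obtain ⟨k, hk⟩ := exists_nat_gt (2 / c)
    have h' := h (k + 3) (alphaGB k) (betaGB k)
    rw [dH_alphaGB_betaGB, dBgen_alphaGB_betaGB] at h'
    rw [div_lt_iff₀ hc] at hk
    nlinarith
end

section
/- Let P be a nonempty finite list of partial ballots on m candidates. For candidates A and B, define D̄_B(A,B) as the average over the ballots σ in P of the average, over all completions τ of σ, of |τ(A) − τ(B)|, where τ(·) denotes a candidate's position in the complete ballot τ. Then D̄_B is a metric on the set of candidates: it is nonnegative and symmetric, D̄_B(A,B) = 0 if and only if A = B, and D̄_B(A,C) ≤ D̄_B(A,B) + D̄_B(B,C) for all candidates A, B, C. -/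
instance ballotFinite (m : ℕ) : Finite (Ballot m) :=
  Finite.of_injective
    (fun σ : Ballot m => (fun i => (⟨σ.1 i, Nat.lt_succ_of_le (σ.2.1 i).2⟩ : Fin (m + 1))))
    (fun σ τ h => Subtype.ext (funext fun i => congrArg Fin.val (congrFun h i)))

/-- `τ` is a completion of the partial ballot `σ`: a complete ballot (injective rank
function) agreeing with `σ` on all of `σ`'s listed candidates, i.e. obtained from `σ`
by appending the unlisted candidates in some order. -/
def IsCompletion (m : ℕ) (τ σ : Ballot m) : Prop :=
  Function.Injective τ.1 ∧ ∀ i, σ.1 i < m → τ.1 i = σ.1 i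

/-- The (finite) set of completions of a partial ballot. -/
noncomputable def completions (m : ℕ) (σ : Ballot m) : Finset (Ballot m) :=
  (Set.toFinite {τ : Ballot m | IsCompletion m τ σ}).toFinset

/-- The candidate dissimilarity `D̄_B(A,B)` for a preference profile `P`: the average
over the ballots `σ` of `P` of the average, over all completions `τ` of `σ`, of the
absolute difference of the positions of `A` and `B` in `τ`. -/
noncomputable def DbarB (m : ℕ) (P : List (Ballot m)) (A B : Fin m) : ℝ :=
  (P.map (fun σ =>
    (∑ τ ∈ completions m σ, |(τ.1 A : ℝ) - (τ.1 B : ℝ)|) / ((completions m σ).card : ℝ))).sum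
    / (P.length : ℝ)

theorem mem_completions {m : ℕ} {σ τ : Ballot m} :
    τ ∈ completions m σ ↔ IsCompletion m τ σ := by
  simp [completions]

/-- Every partial ballot has a completion. -/
theorem completions_nonempty (m : ℕ) (σ : Ballot m) : (completions m σ).Nonempty := by
  obtain ⟨g, hg⟩ := Finset.exists_equiv_extend_of_card_eq
    (α := Fin m) (t := Finset.Icc 1 m) (by simp)
    (s := Finset.univ.filter fun i => σ.1 i < m) (f := σ.1)
    (by
      intro j hj
      obtain ⟨i, -, rfl⟩ := Finset.mem_image.mp hj
      exact Finset.mem_Icc.mpr (σ.2.1 i))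
    (by
      intro i hi i' _ h
      exact σ.2.2.1 i i' (by simpa using hi) h)
  have inj : Function.Injective fun i => (g i : ℕ) :=
    Subtype.val_injective.comp g.injective
  refine ⟨⟨fun i => g i, fun i => Finset.mem_Icc.mp (g i).2, fun i i' _ h => inj h, ?_⟩,
    mem_completions.mpr ⟨inj, fun i hi => hg i (by simpa using hi)⟩⟩
  intro i j hj hji hi
  exact ⟨g.symm ⟨j, Finset.mem_Icc.mpr ⟨hj, (hji.trans_lt hi).le⟩⟩, by simp⟩

/-- The average distance between the positions of `A` and `B` over the completions of `σ`. -/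
noncomputable def completionDist {m : ℕ} (A B : Fin m) (σ : Ballot m) : ℝ :=
  (∑ τ ∈ completions m σ, |(τ.1 A : ℝ) - (τ.1 B : ℝ)|) / ((completions m σ).card : ℝ)

theorem DbarB_eq {m : ℕ} (P : List (Ballot m)) (A B : Fin m) :
    DbarB m P A B = (P.map (completionDist A B)).sum / (P.length : ℝ) := rfl

theorem completionDist_self {m : ℕ} (A : Fin m) (σ : Ballot m) : completionDist A A σ = 0 := by
  simp [completionDist]

theorem completionDist_comm {m : ℕ} (A B : Fin m) (σ : Ballot m) :
    completionDist A B σ = completionDist B A σ := by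
  simp only [completionDist, abs_sub_comm]

theorem completionDist_nonneg {m : ℕ} (A B : Fin m) (σ : Ballot m) :
    0 ≤ completionDist A B σ := by
  unfold completionDist
  positivity

theorem completionDist_pos {m : ℕ} {A B : Fin m} (h : A ≠ B) (σ : Ballot m) :
    0 < completionDist A B σ := by
  have hne := completions_nonempty m σ
  refine div_pos (Finset.sum_pos (fun τ hτ => ?_) hne) (by exact_mod_cast hne.card_pos)
  rw [abs_pos, sub_ne_zero, Nat.cast_injective.ne_iff]
  exact (mem_completions.mp hτ).1.ne h

theorem completionDist_triangle {m : ℕ} (A B C : Fin m) (σ : Ballot m) :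
    completionDist A C σ ≤ completionDist A B σ + completionDist B C σ := by
  unfold completionDist
  rw [← add_div, ← Finset.sum_add_distrib]
  gcongr
  exact abs_sub_le _ _ _

/-- For a nonempty finite list `P` of partial ballots on `m`
candidates, `D̄_B` is a metric on the set of candidates: nonnegative, symmetric, zero
exactly on the diagonal, and satisfying the triangle inequality. -/
theorem DbarB_isMetric (m : ℕ) (P : List (Ballot m)) (hP : P ≠ []) :
    (∀ A B : Fin m, 0 ≤ DbarB m P A B) ∧
    (∀ A B : Fin m, DbarB m P A B = DbarB m P B A) ∧
    (∀ A B : Fin m, DbarB m P A B = 0 ↔ A = B) ∧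
    (∀ A B C : Fin m, DbarB m P A C ≤ DbarB m P A B + DbarB m P B C) := by
  have hlen : (0 : ℝ) < P.length := by exact_mod_cast List.length_pos_of_ne_nil hP
  have nonneg : ∀ A B : Fin m, 0 ≤ DbarB m P A B := fun A B =>
    div_nonneg (List.sum_nonneg (by
      intro x hx
      obtain ⟨σ, -, rfl⟩ := List.mem_map.mp hx
      exact completionDist_nonneg A B σ)) hlen.le
  refine ⟨nonneg, fun A B => ?_, fun A B => ⟨fun h => ?_, ?_⟩, fun A B C => ?_⟩
  · simp only [DbarB_eq, funext (completionDist_comm A B)]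
  · by_contra hAB
    refine h.not_gt (div_pos (List.sum_pos _ (fun x hx => ?_) (by simpa using hP)) hlen)
    obtain ⟨σ, -, rfl⟩ := List.mem_map.mp hx
    exact completionDist_pos hAB σ
  · rintro rfl
    simp [DbarB_eq, funext (completionDist_self A)]
  · rw [DbarB_eq, DbarB_eq, DbarB_eq, ← add_div, ← List.sum_map_add]
    gcongr
    exact List.sum_le_sum fun σ _ => completionDist_triangle A B C σ
end

section
/- For partial ballots σ, τ on m candidates, let wk(σ→τ) denote the number of candidate pairs tied by σ (i.e., both unlisted in σ) but strictly ordered by τ, and let wk(τ→σ) be defined symmetrically, so that wk(σ,τ) = wk(σ→τ) + wk(τ→σ). Define the Hausdorff distance d_Haus(σ,τ) = str(σ,τ) + max(wk(σ→τ), wk(τ→σ)). Then for all partial ballots σ, τ: d_H(σ,τ) ≤ d_Haus(σ,τ) ≤ 2·d_B(σ,τ). -/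
/-- `wkDir σ τ` = `wk(σ→τ)`: the number of candidate pairs tied by `σ` but strictly
ordered by `τ`. -/
def wkDir {m : ℕ} (σ τ : Fin m → ℕ) : ℕ :=
  (Finset.univ.filter (fun p : Fin m × Fin m => p.1 < p.2 ∧
    σ p.1 = σ p.2 ∧ τ p.1 ≠ τ p.2)).card

/-- The Hausdorff distance `d_Haus(σ,τ) = str(σ,τ) + max(wk(σ→τ), wk(τ→σ))`. -/
noncomputable def dHaus {m : ℕ} (σ τ : Fin m → ℕ) : ℝ :=
  (strDis σ τ : ℝ) + (max (wkDir σ τ) (wkDir τ σ) : ℝ)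

theorem wkDis_eq_wkDir_add_wkDir {m : ℕ} (σ τ : Fin m → ℕ) :
    wkDis σ τ = wkDir σ τ + wkDir τ σ := by
  unfold wkDis wkDir
  rw [← Finset.card_union_of_disjoint]
  · congr 1
    ext p
    simp only [Finset.mem_filter, Finset.mem_univ, true_and, Finset.mem_union]
    tauto
  · rw [Finset.disjoint_filter]
    tauto

/-- `d_H` counts a strong disagreement once and a weak disagreement with weight `1/2`. -/
theorem dH_eq_strDis_add_half_wkDir {m : ℕ} (σ τ : Fin m → ℕ) :
    dH σ τ = strDis σ τ + (1 / 2) * ((wkDir σ τ : ℝ) + wkDir τ σ) := by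
  have key : ∀ p : Fin m × Fin m, |hcoord σ p.1 p.2 - hcoord τ p.1 p.2| =
      2 * (if (σ p.1 < σ p.2 ∧ τ p.2 < τ p.1) ∨ (σ p.2 < σ p.1 ∧ τ p.1 < τ p.2)
        then (1 : ℝ) else 0)
      + ((if σ p.1 = σ p.2 ∧ τ p.1 ≠ τ p.2 then (1 : ℝ) else 0)
      + (if τ p.1 = τ p.2 ∧ σ p.1 ≠ σ p.2 then (1 : ℝ) else 0)) := by
    intro p
    unfold hcoord
    rcases lt_trichotomy (σ p.1) (σ p.2) with h | h | h <;>
    rcases lt_trichotomy (τ p.1) (τ p.2) with h' | h' | h' <;>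
    simp only [h, h', not_lt_of_gt, ne_of_lt, ne_of_gt, lt_irrefl, ne_eq, if_true, if_false,
      and_self, and_true, and_false, or_true, or_false, not_true, not_false_eq_true] <;>
    norm_num
  unfold dH strDis wkDir
  simp only [key, Finset.sum_add_distrib, ← Finset.mul_sum, Finset.sum_boole,
    Finset.filter_filter]
  ring

theorem dH_le_dHaus {m : ℕ} (σ τ : Fin m → ℕ) : dH σ τ ≤ dHaus σ τ := by
  rw [dH_eq_strDis_add_half_wkDir, dHaus]
  linarith [le_max_left (wkDir σ τ : ℝ) (wkDir τ σ), le_max_right (wkDir σ τ : ℝ) (wkDir τ σ)]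

theorem strDis_comm {m : ℕ} (σ τ : Fin m → ℕ) : strDis σ τ = strDis τ σ := by
  unfold strDis
  congr 1
  ext p
  simp only [Finset.mem_filter, Finset.mem_univ, true_and]
  tauto

/-- Orienting each disagreeing pair so that `τ` prefers its second entry. -/
theorem strDis_add_wkDir_le_card {m : ℕ} (σ τ : Fin m → ℕ) :
    strDis σ τ + wkDir σ τ ≤
      (Finset.univ.filter (fun p : Fin m × Fin m => τ p.2 < τ p.1 ∧ σ p.1 ≤ σ p.2)).card := by
  unfold strDis wkDir
  rw [← Finset.card_union_of_disjoint]
  · apply Finset.card_le_card_of_injOn (fun p => if τ p.2 < τ p.1 then p else p.swap)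
    · intro p hp
      simp only [Finset.coe_union, Finset.coe_filter, Finset.mem_univ, true_and, Set.mem_union,
        Set.mem_ofPred_eq] at hp
      by_cases h : τ p.2 < τ p.1
      · simp only [if_pos h, Finset.coe_filter, Finset.mem_univ, true_and, Set.mem_ofPred_eq]
        omega
      · simp only [if_neg h, Finset.coe_filter, Finset.mem_univ, true_and, Set.mem_ofPred_eq,
          Prod.fst_swap, Prod.snd_swap]
        omega
    · intro p hp q hq hpq
      have hp' : p.1 < p.2 := by
        rcases Finset.mem_union.1 hp with h | h <;> exact (Finset.mem_filter.1 h).2.1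
      have hq' : q.1 < q.2 := by
        rcases Finset.mem_union.1 hq with h | h <;> exact (Finset.mem_filter.1 h).2.1
      obtain ⟨p1, p2⟩ := p
      obtain ⟨q1, q2⟩ := q
      dsimp only at hpq hp' hq'
      split_ifs at hpq <;> simp only [Prod.swap_prod_mk, Prod.mk.injEq] at hpq ⊢ <;> omega
  · rw [Finset.disjoint_filter]
    intro p _ h h'
    omega

namespace IsBallot

variable {m : ℕ} {σ τ : Fin m → ℕ}

theorem card_filter_mem_le (hσ : IsBallot m σ) (s : Finset ℕ) :
    (Finset.univ.filter (fun j => σ j ∈ s ∧ σ j < m)).card ≤ s.card := by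
  apply Finset.card_le_card_of_injOn σ
  · intro j hj
    exact (Finset.mem_filter.1 hj).2.1
  · intro i hi j _ h
    exact hσ.2.1 i j (Finset.mem_filter.1 hi).2.2 h

/-- At most `m - τ e` candidates are ranked strictly worse than `e`: the positions `1, …, τ e`
of a listed candidate `e` are all occupied. -/
theorem card_filter_lt_le (hτ : IsBallot m τ) (e : Fin m) :
    (Finset.univ.filter (fun i => τ e < τ i)).card ≤ m - τ e := by
  rcases (hτ.1 e).2.eq_or_lt with he | he
  · rw [Finset.filter_false_of_mem]
    · simp
    · intro i _
      have := (hτ.1 i).2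
      omega
  · have h1 : (Finset.Icc 1 (τ e)).card ≤ (Finset.univ.filter (fun i => ¬ τ e < τ i)).card := by
      apply Finset.card_le_card_of_surjOn τ
      intro j hj
      obtain ⟨hj1, hj2⟩ := Finset.mem_Icc.1 hj
      obtain ⟨i, hi⟩ := hτ.2.2 e j hj1 hj2 he
      refine ⟨i, ?_, hi⟩
      simp only [Finset.coe_filter, Finset.mem_univ, true_and, Set.mem_ofPred_eq]
      omega
    have h2 := Finset.card_filter_add_card_filter_not (s := (Finset.univ : Finset (Fin m)))
      (fun i => τ e < τ i)
    rw [Finset.card_univ, Fintype.card_fin] at h2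
    rw [Nat.card_Icc] at h1
    omega

theorem card_charge_snd_le (hσ : IsBallot m σ) (hτ : IsBallot m τ) (e : Fin m) :
    (Finset.univ.filter
      (fun i => τ e < τ i ∧ τ e < σ e ∧ (σ e = m ∨ τ i < σ e))).card ≤ σ e - τ e := by
  rcases (hσ.1 e).2.eq_or_lt with he | he
  · rw [he]
    refine le_trans (Finset.card_le_card ?_) (hτ.card_filter_lt_le e)
    intro i hi
    simp only [Finset.mem_filter, Finset.mem_univ, true_and] at hi ⊢
    exact hi.1
  · have h := hτ.card_filter_mem_le (Finset.Ioo (τ e) (σ e))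
    rw [Nat.card_Ioo] at h
    refine le_trans (Finset.card_le_card ?_) (h.trans (Nat.sub_le _ _))
    intro i hi
    simp only [Finset.mem_filter, Finset.mem_univ, true_and, Finset.mem_Ioo] at hi ⊢
    omega

/-- Each disagreement is charged to one of its two candidates in such a way that a candidate `e`
is charged at most `|σ e - τ e|` times. -/
theorem card_disagreements_le (hσ : IsBallot m σ) (hτ : IsBallot m τ) :
    (Finset.univ.filter (fun p : Fin m × Fin m => τ p.2 < τ p.1 ∧ σ p.1 ≤ σ p.2)).card ≤
      ∑ e, ((τ e - σ e) + (σ e - τ e)) := by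
  have hsub : Finset.univ.filter (fun p : Fin m × Fin m => τ p.2 < τ p.1 ∧ σ p.1 ≤ σ p.2) ⊆
      Finset.univ.filter (fun p : Fin m × Fin m =>
        σ p.2 ∈ Finset.Ioc (σ p.1) (τ p.1) ∧ σ p.2 < m) ∪
      Finset.univ.filter (fun p : Fin m × Fin m =>
        τ p.2 < τ p.1 ∧ τ p.2 < σ p.2 ∧ (σ p.2 = m ∨ τ p.1 < σ p.2)) := by
    rintro ⟨i, j⟩ h
    simp only [Finset.mem_union, Finset.mem_filter, Finset.mem_univ, true_and,
      Finset.mem_Ioc] at h ⊢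
    have hi := (hτ.1 i).2
    have hj := (hσ.1 j).2
    have hne : σ i = σ j → ¬ σ i < m := by
      intro h1 h2
      have := hσ.2.1 i j h2 h1
      subst this
      omega
    omega
  refine (Finset.card_le_card hsub).trans ((Finset.card_union_le _ _).trans ?_)
  rw [Finset.sum_add_distrib]
  refine add_le_add ?_ ?_
  · rw [Finset.card_filter, Fintype.sum_prod_type]
    refine Finset.sum_le_sum fun e _ => ?_
    rw [← Finset.card_filter]
    exact (hσ.card_filter_mem_le (Finset.Ioc (σ e) (τ e))).trans (Nat.card_Ioc _ _).le
  · rw [Finset.card_filter, Fintype.sum_prod_type_right]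
    refine Finset.sum_le_sum fun e _ => ?_
    rw [← Finset.card_filter]
    exact hσ.card_charge_snd_le hτ e

theorem strDis_add_wkDir_le_two_dB (hσ : IsBallot m σ) (hτ : IsBallot m τ) :
    (strDis σ τ : ℝ) + wkDir σ τ ≤ 2 * dB m σ τ := by
  have h := (strDis_add_wkDir_le_card σ τ).trans (hσ.card_disagreements_le hτ)
  have h' : (strDis σ τ : ℝ) + wkDir σ τ ≤ ((∑ e, ((τ e - σ e) + (σ e - τ e)) : ℕ) : ℝ) := by
    exact_mod_cast h
  refine h'.trans (le_of_eq ?_)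
  rw [dB, ← mul_assoc, Nat.cast_sum]
  norm_num
  refine Finset.sum_congr rfl fun e _ => ?_
  rw [bordaEmb, bordaEmb, sub_sub_sub_cancel_left]
  rcases le_total (σ e) (τ e) with h | h
  · rw [Nat.sub_eq_zero_of_le h, Nat.cast_sub h, abs_of_nonneg (by simpa using h)]
    simp
  · rw [Nat.sub_eq_zero_of_le h, Nat.cast_sub h, abs_of_nonpos (by simpa using h)]
    simp

end IsBallot

theorem dB_comm (m : ℕ) (σ τ : Fin m → ℕ) : dB m σ τ = dB m τ σ := by
  simp only [dB, abs_sub_comm]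

/-- For all partial ballots `σ, τ` on `m` candidates,
`wk(σ,τ) = wk(σ→τ) + wk(τ→σ)` and `d_H(σ,τ) ≤ d_Haus(σ,τ) ≤ 2·d_B(σ,τ)`. -/
theorem dH_le_dHaus_le_two_dB (m : ℕ) (σ τ : Ballot m) :
    wkDis σ.1 τ.1 = wkDir σ.1 τ.1 + wkDir τ.1 σ.1 ∧
    dH σ.1 τ.1 ≤ dHaus σ.1 τ.1 ∧
    dHaus σ.1 τ.1 ≤ 2 * dB m σ.1 τ.1 := by
  refine ⟨wkDis_eq_wkDir_add_wkDir _ _, dH_le_dHaus _ _, ?_⟩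
  have h1 := σ.2.strDis_add_wkDir_le_two_dB τ.2
  have h2 := τ.2.strDis_add_wkDir_le_two_dB σ.2
  rw [strDis_comm, dB_comm] at h2
  rw [dHaus, ← max_add_add_left]
  exact max_le h1 h2
end

section
/- Consider 5 candidates A, B, C, D, E and the complete ballots σ = (A,B,C,D,E), τ = (E,B,C,D,A), and π = (D,B,C,A,E). Then str(σ,τ) = 7, d_B(σ,τ) = 4, str(σ,π) = 5, d_B(σ,π) = 3, and wk(σ,τ) = wk(σ,π) = 0. Consequently, there exist no real numbers a, b such that d_B(ρ,ρ') = a·str(ρ,ρ') + b·wk(ρ,ρ') for all partial ballots ρ, ρ' on 5 candidates; in particular, the Borda distance d_B is not a constant multiple of any of the distances K^(p) = str + p·wk. -/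
/-- The complete ballot `σ = (A,B,C,D,E)` on 5 candidates. -/
def sigma15 : Ballot 5 :=
  ⟨![1, 2, 3, 4, 5], by
    refine ⟨by decide, by decide, ?_⟩
    intro i j h1 h2 h3
    have hj : j < 5 := lt_of_le_of_lt h2 h3
    interval_cases j <;> decide⟩

/-- The complete ballot `τ = (E,B,C,D,A)` on 5 candidates. -/
def tau15 : Ballot 5 :=
  ⟨![5, 2, 3, 4, 1], by
    refine ⟨by decide, by decide, ?_⟩
    intro i j h1 h2 h3
    have hj : j < 5 := lt_of_le_of_lt h2 h3
    interval_cases j <;> decide⟩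

/-- The complete ballot `π = (D,B,C,A,E)` on 5 candidates. -/
def pi15 : Ballot 5 :=
  ⟨![4, 2, 3, 1, 5], by
    refine ⟨by decide, by decide, ?_⟩
    intro i j h1 h2 h3
    have hj : j < 5 := lt_of_le_of_lt h2 h3
    interval_cases j <;> decide⟩

/-- For `σ = (A,B,C,D,E)`, `τ = (E,B,C,D,A)`, `π = (D,B,C,A,E)` on 5
candidates one has `str(σ,τ) = 7`, `d_B(σ,τ) = 4`, `str(σ,π) = 5`, `d_B(σ,π) = 3` and
`wk(σ,τ) = wk(σ,π) = 0`; consequently there are no reals `a, b` with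
`d_B = a·str + b·wk` on all partial ballots on 5 candidates, so `d_B` is not a
constant multiple of any `K^(p) = str + p·wk`. -/
theorem dB_not_affine_in_str_wk :
    strDis sigma15.1 tau15.1 = 7 ∧ dB 5 sigma15.1 tau15.1 = 4 ∧
    strDis sigma15.1 pi15.1 = 5 ∧ dB 5 sigma15.1 pi15.1 = 3 ∧
    wkDis sigma15.1 tau15.1 = 0 ∧ wkDis sigma15.1 pi15.1 = 0 ∧
    (¬ ∃ a b : ℝ, ∀ ρ ρ' : Ballot 5,
      dB 5 ρ.1 ρ'.1 = a * (strDis ρ.1 ρ'.1 : ℝ) + b * (wkDis ρ.1 ρ'.1 : ℝ)) ∧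
    (¬ ∃ c p : ℝ, ∀ ρ ρ' : Ballot 5,
      dB 5 ρ.1 ρ'.1 = c * ((strDis ρ.1 ρ'.1 : ℝ) + p * (wkDis ρ.1 ρ'.1 : ℝ))) := by
  have str_tau : strDis sigma15.1 tau15.1 = 7 := by decide
  have str_pi : strDis sigma15.1 pi15.1 = 5 := by decide
  have wk_tau : wkDis sigma15.1 tau15.1 = 0 := by decide
  have wk_pi : wkDis sigma15.1 pi15.1 = 0 := by decide
  have dB_tau : dB 5 sigma15.1 tau15.1 = 4 := by
    norm_num [dB, bordaEmb, sigma15, tau15, Fin.sum_univ_succ, abs_of_pos, abs_of_neg]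
  have dB_pi : dB 5 sigma15.1 pi15.1 = 3 := by
    norm_num [dB, bordaEmb, sigma15, pi15, Fin.sum_univ_succ, abs_of_pos, abs_of_neg]
  have not_affine : ¬ ∃ a b : ℝ, ∀ ρ ρ' : Ballot 5,
      dB 5 ρ.1 ρ'.1 = a * (strDis ρ.1 ρ'.1 : ℝ) + b * (wkDis ρ.1 ρ'.1 : ℝ) := by
    rintro ⟨a, b, h⟩
    have h_tau := h sigma15 tau15
    have h_pi := h sigma15 pi15
    rw [dB_tau, str_tau, wk_tau] at h_tau
    rw [dB_pi, str_pi, wk_pi] at h_pi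
    push_cast at h_tau h_pi
    linarith
  refine ⟨str_tau, dB_tau, str_pi, dB_pi, wk_tau, wk_pi, not_affine, ?_⟩
  rintro ⟨c, p, h⟩
  exact not_affine ⟨c, c * p, fun ρ ρ' => by rw [h]; ring⟩
end
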